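/- arXiv:0804.4137 — 6 statements merged into one kernel-verified Lean document; each statement's English description precedes it below -/
import Mathlib

section
/- Let M ≥ 2 and let A = (A_{ij}) be a real M × M matrix with A_{ij} ≥ 0 for all j ≥ i. Let T > 0 and let u_0 ∈ [W^{1,∞}(ℝ)]^M with each component u_0^i nondecreasing. Then the system ∂_t u^i + (Σ_{j=1}^M A_{ij} u^j) ∂_x u^i = 0 on (0,T) × ℝ, for i = 1,…,M, with initial data u(0,·) = u_0, admits a unique solution u in [W^{1,∞}([0,T) × ℝ)]^M (i.e. u is bounded and Lipschitz on [0,T) × ℝ and satisfies the equations almost everywhere). -/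
open MeasureTheory Real Set NNReal

/-- `u` is a `W^{1,∞}` solution on `[0,T) × ℝ` of the diagonal system
`∂_t u^i + (Σ_j A_{ij} u^j) ∂_x u^i = 0` with initial data `u₀`: it is bounded and Lipschitz
on `[0,T) × ℝ`, satisfies the equations at almost every point (its partial derivatives exist
a.e. by Rademacher's theorem), and `u(0,·) = u₀`. -/
def IsW1infSolution (M : ℕ) (A : Fin M → Fin M → ℝ) (T : ℝ)
    (u0 : ℝ → Fin M → ℝ) (u : ℝ → ℝ → Fin M → ℝ) : Prop :=
  (∃ L : ℝ≥0, LipschitzOnWith L (fun p : ℝ × ℝ => u p.1 p.2)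
    (Set.Ico 0 T ×ˢ (Set.univ : Set ℝ))) ∧
  (∃ B : ℝ, ∀ t ∈ Set.Ico 0 T, ∀ x : ℝ, ∀ i, |u t x i| ≤ B) ∧
  (∀ i : Fin M, ∀ᵐ p : ℝ × ℝ, p.1 ∈ Set.Ioo 0 T →
    ∃ ut ux : ℝ, HasDerivAt (fun s => u s p.2 i) ut p.1 ∧
      HasDerivAt (fun y => u p.1 y i) ux p.2 ∧
      ut + (∑ j, A i j * u p.1 p.2 j) * ux = 0) ∧
  (∀ x : ℝ, u 0 x = u0 x)

/-- The chain rule along a graph `r ↦ (r, γ r)`, with the derivative of a function of two real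
variables expressed by its partial derivatives. -/
lemma hasDerivAt_along_graph {w : ℝ → ℝ → ℝ} {γ : ℝ → ℝ} {s c ut ux : ℝ}
    (hw : DifferentiableAt ℝ (fun p : ℝ × ℝ => w p.1 p.2) (s, γ s))
    (hγ : HasDerivAt γ c s) (ht : HasDerivAt (fun r => w r (γ s)) ut s)
    (hx : HasDerivAt (fun y => w s y) ux (γ s)) :
    HasDerivAt (fun r => w r (γ r)) (ut + c * ux) s := by
  obtain ⟨F, hF⟩ := hw
  have h1 : HasDerivAt (fun r => w r (γ s)) (F (1, 0)) s :=
    HasFDerivAt.comp_hasDerivAt (f := fun r => (r, γ s)) s hF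
      ((hasDerivAt_id s).prodMk (hasDerivAt_const s (γ s)))
  have h2 : HasDerivAt (fun y => w s y) (F (0, 1)) (γ s) :=
    HasFDerivAt.comp_hasDerivAt (f := fun y => (s, y)) (γ s) hF
      ((hasDerivAt_const (γ s) s).prodMk (hasDerivAt_id (γ s)))
  have h3 : HasDerivAt (fun r => w r (γ r)) (F (1, c)) s :=
    HasFDerivAt.comp_hasDerivAt (f := fun r => (r, γ r)) s hF
      ((hasDerivAt_id s).prodMk hγ)
  have h4 : F (1, c) = ut + c * ux := by
    rw [ht.unique h1, hx.unique h2, ← smul_eq_mul, ← map_smul, ← map_add]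
    simp
  rwa [h4] at h3

/-- Rademacher's theorem on an open time strip. -/
lemma ae_differentiableAt_of_lipschitzOnWith_strip {w : ℝ → ℝ → ℝ} {t : ℝ} {Λ : ℝ≥0}
    (hw : LipschitzOnWith Λ (fun p : ℝ × ℝ => w p.1 p.2) (Icc 0 t ×ˢ univ)) :
    ∀ᵐ p : ℝ × ℝ, p.1 ∈ Ioo 0 t → DifferentiableAt ℝ (fun p : ℝ × ℝ => w p.1 p.2) p := by
  filter_upwards [hw.ae_differentiableWithinAt_of_mem (μ := volume)] with p hp hpt
  refine (hp ⟨Ioo_subset_Icc_self hpt, mem_univ _⟩).differentiableAt ?_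
  exact prod_mem_nhds (Icc_mem_nhds hpt.1 hpt.2) Filter.univ_mem

/-- Comparison along an arbitrary curve `γ` of a Lipschitz almost everywhere solution `w` of the
transport equation `∂_t w + b ∂_x w = 0`, in terms of the mismatch between the velocity of `γ` and
the speed `b`. The proof moves `γ` by a generic spatial shift, so that the equation holds at almost
every time along the shifted curve. -/
lemma abs_sub_le_of_ae_transport {t K : ℝ} (ht : 0 ≤ t) {Λ C : ℝ≥0} {w b : ℝ → ℝ → ℝ}
    {c ε γ : ℝ → ℝ}
    (hw : LipschitzOnWith Λ (fun p : ℝ × ℝ => w p.1 p.2) (Icc 0 t ×ˢ univ))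
    (hpde : ∀ᵐ p : ℝ × ℝ, p.1 ∈ Ioo 0 t → ∃ ut ux : ℝ,
      HasDerivAt (fun s => w s p.2) ut p.1 ∧ HasDerivAt (fun y => w p.1 y) ux p.2 ∧
        ut + b p.1 p.2 * ux = 0)
    (hγ : ∀ s ∈ Ioo 0 t, HasDerivAt γ (c s) s) (hγlip : LipschitzOnWith C γ (Icc 0 t))
    (hε : Continuous ε)
    (hcb : ∀ s ∈ Ioo 0 t, ∀ h, |c s - b s (γ s + h)| ≤ ε s + K * |h|) :
    |w t (γ t) - w 0 (γ 0)| ≤ Λ * ∫ s in 0..t, ε s := by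
  set γ' : ℝ → ℝ := IccExtend ht ((Icc 0 t).domRestrict γ) with hγ'
  have hγ'c : Continuous γ' := (hγlip.continuousOn.domRestrict).Icc_extend'
  have hγ'eq : ∀ s ∈ Icc 0 t, γ' s = γ s := fun s hs => by
    rw [hγ', IccExtend_of_mem _ _ hs]; rfl
  have hshear : MeasurePreserving (fun z : ℝ × ℝ => (z.1, γ' z.1 + z.2))
      (volume.prod volume) (volume.prod volume) :=
    (MeasurePreserving.id volume).skew_product (g := fun s h => γ' s + h)
      (by unfold Function.uncurry; fun_prop)
      (Filter.Eventually.of_forall fun s => map_add_left_eq_self volume (γ' s))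
  have hmp := hshear.comp (Measure.measurePreserving_swap (μ := (volume : Measure ℝ))
    (ν := (volume : Measure ℝ)))
  have hgood := Measure.ae_ae_of_ae_prod (hmp.quasiMeasurePreserving.ae
    ((ae_differentiableAt_of_lipschitzOnWith_strip hw).and hpde))
  have hslice : ∀ s ∈ Icc 0 t, LipschitzWith Λ (w s) := fun s hs =>
    LipschitzWith.of_dist_le_mul fun x y => by
      simpa [Prod.dist_eq] using hw.dist_le_mul (s, x) ⟨hs, mem_univ _⟩ (s, y) ⟨hs, mem_univ _⟩
  have hshift : ∀ᵐ h : ℝ, |w t (γ t + h) - w 0 (γ 0 + h)| ≤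
      ∫ s in 0..t, (Λ : ℝ) * (ε s + K * |h|) := by
    filter_upwards [hgood] with h hh
    have hlip : LipschitzOnWith (Λ * max 1 C) (fun s => w s (γ s + h)) (Icc 0 t) := by
      refine LipschitzOnWith.comp (g := fun p : ℝ × ℝ => w p.1 p.2) (f := fun s => (s, γ s + h))
        hw ?_ (fun s hs => ⟨hs, mem_univ _⟩)
      refine LipschitzOnWith.prodMk (LipschitzWith.id.lipschitzOnWith) ?_
      exact LipschitzOnWith.of_dist_le_mul fun x hx y hy => by
        simpa using hγlip.dist_le_mul x hx y hy
    rw [← uIcc_of_le ht] at hlip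
    rw [← hlip.absolutelyContinuousOnInterval.integral_deriv_eq_sub, ← Real.norm_eq_abs]
    refine intervalIntegral.norm_integral_le_of_norm_le ht ?_
      (Continuous.intervalIntegrable (by fun_prop) _ _)
    filter_upwards [hh, compl_mem_ae_iff.2 (measure_singleton t)] with s hs hst hs0
    have hs' : s ∈ Ioo 0 t := ⟨hs0.1, lt_of_le_of_ne hs0.2 hst⟩
    have hsI := Ioo_subset_Icc_self hs'
    simp only [Function.comp, Prod.swap, hγ'eq s hsI] at hs
    obtain ⟨hd, hp⟩ := hs
    obtain ⟨ut, ux, h1, h2, h3⟩ := hp hs'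
    have hder := hasDerivAt_along_graph (γ := fun r => γ r + h) (hd hs')
      ((hγ s hs').add_const h) h1 h2
    rw [hder.deriv]
    have hux : |ux| ≤ Λ := by
      rw [← h2.deriv, ← Real.norm_eq_abs]
      exact norm_deriv_le_of_lipschitz (hslice s hsI)
    have : ut + c s * ux = ux * (c s - b s (γ s + h)) := by linear_combination h3
    rw [this, norm_mul, Real.norm_eq_abs, Real.norm_eq_abs]
    exact mul_le_mul hux (hcb s hs' h) (abs_nonneg _) Λ.2
  have hclosed : IsClosed {h : ℝ | |w t (γ t + h) - w 0 (γ 0 + h)| ≤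
      ∫ s in 0..t, (Λ : ℝ) * (ε s + K * |h|)} := by
    have e1 := (hslice t ⟨ht, le_rfl⟩).continuous
    have e2 := (hslice 0 ⟨le_rfl, ht⟩).continuous
    refine isClosed_le (by fun_prop) ?_
    have : (fun h : ℝ => ∫ s in 0..t, (Λ : ℝ) * (ε s + K * |h|)) =
        fun h => Λ * ((∫ s in 0..t, ε s) + t * (K * |h|)) := by
      ext h
      rw [intervalIntegral.integral_const_mul, intervalIntegral.integral_add
        (hε.intervalIntegrable _ _) (by simp)]
      simp only [intervalIntegral.integral_const, smul_eq_mul, sub_zero]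
    rw [this]
    fun_prop
  have := hclosed.closure_eq ▸ (Measure.dense_of_ae hshift).closure_eq ▸ mem_univ (0 : ℝ)
  simpa using this

/-- A speed on `[0,T] × ℝ` that is bounded by `C`, continuous in time and `K`-Lipschitz in space. -/
structure IsSpeed (T : ℝ) (C K : ℝ≥0) (a : ℝ → ℝ → ℝ) : Prop where
  lipschitz : ∀ t ∈ Icc 0 T, LipschitzWith K (a t)
  continuousOn : ∀ x, ContinuousOn (fun t => a t x) (Icc 0 T)
  bound : ∀ t ∈ Icc 0 T, ∀ x, |a t x| ≤ C

namespace IsSpeed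

variable {T : ℝ} {C K : ℝ≥0} {a : ℝ → ℝ → ℝ} {γ δ : ℝ → ℝ} {τ : ℝ}

lemma exists_integralCurve (ha : IsSpeed T C K a) (hτ : τ ∈ Icc 0 T) (x : ℝ) :
    ∃ γ : ℝ → ℝ, γ τ = x ∧ IsIntegralCurveOn γ a (Icc 0 T) := by
  have hT : 0 ≤ T := hτ.1.trans hτ.2
  have hpl : IsPicardLindelof a (⟨τ, hτ⟩ : Icc 0 T) x (C * T.toNNReal) 0 C K :=
    { lipschitzOnWith := fun t ht => (ha.lipschitz t ht).lipschitzOnWith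
      continuousOn := fun y _ => ha.continuousOn y
      norm_le := fun t ht y _ => ha.bound t ht y
      mul_max_le := by
        simp only [NNReal.coe_mul, NNReal.coe_zero, sub_zero, Real.coe_toNNReal _ hT]
        exact mul_le_mul_of_nonneg_left
          (max_le (by linarith [hτ.1]) hτ.2) C.2 }
  exact hpl.exists_eq_forall_mem_Icc_hasDerivWithinAt₀

lemma eqOn (ha : IsSpeed T C K a) (hγ : IsIntegralCurveOn γ a (Icc 0 T))
    (hδ : IsIntegralCurveOn δ a (Icc 0 T)) (hτ : τ ∈ Icc 0 T) (h : γ τ = δ τ) :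
    EqOn γ δ (Icc 0 T) := by
  have hright : ∀ {η : ℝ → ℝ}, IsIntegralCurveOn η a (Icc 0 T) →
      ∀ s ∈ Ico τ T, HasDerivWithinAt η (a s (η s)) (Ici s) s := fun hη s hs =>
    (hη s ⟨hτ.1.trans hs.1, hs.2.le⟩).mono_of_mem_nhdsWithin
      (Filter.mem_of_superset (Icc_mem_nhdsGE hs.2) (Icc_subset_Icc_left (hτ.1.trans hs.1)))
  have hleft : ∀ {η : ℝ → ℝ}, IsIntegralCurveOn η a (Icc 0 T) →
      ∀ s ∈ Ioc 0 τ, HasDerivWithinAt η (a s (η s)) (Iic s) s := fun hη s hs =>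
    (hη s ⟨hs.1.le, hs.2.trans hτ.2⟩).mono_of_mem_nhdsWithin
      (Filter.mem_of_superset (Icc_mem_nhdsLE hs.1) (Icc_subset_Icc_right (hs.2.trans hτ.2)))
  intro s hs
  rcases le_total τ s with hle | hle
  · exact ODE_solution_unique_of_mem_Icc_right (s := fun _ => univ)
      (fun t ht => (ha.lipschitz t ⟨hτ.1.trans ht.1, ht.2.le⟩).lipschitzOnWith)
      (hγ.continuousOn.mono (Icc_subset_Icc_left hτ.1)) (hright hγ) (fun _ _ => mem_univ _)
      (hδ.continuousOn.mono (Icc_subset_Icc_left hτ.1)) (hright hδ) (fun _ _ => mem_univ _)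
      h ⟨hle, hs.2⟩
  · exact ODE_solution_unique_of_mem_Icc_left (s := fun _ => univ)
      (fun t ht => (ha.lipschitz t ⟨ht.1.le, ht.2.trans hτ.2⟩).lipschitzOnWith)
      (hγ.continuousOn.mono (Icc_subset_Icc_right hτ.2)) (hleft hγ) (fun _ _ => mem_univ _)
      (hδ.continuousOn.mono (Icc_subset_Icc_right hτ.2)) (hleft hδ) (fun _ _ => mem_univ _)
      h ⟨hs.1, hle⟩

lemma integralCurve_le (ha : IsSpeed T C K a) (hγ : IsIntegralCurveOn γ a (Icc 0 T))
    (hδ : IsIntegralCurveOn δ a (Icc 0 T)) (hτ : τ ∈ Icc 0 T) (h : γ τ ≤ δ τ)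
    {s : ℝ} (hs : s ∈ Icc 0 T) : γ s ≤ δ s := by
  by_contra! hlt
  have hsub : uIcc τ s ⊆ Icc 0 T := uIcc_subset_Icc hτ hs
  have hcont : ContinuousOn (fun r => γ r - δ r) (uIcc τ s) :=
    (hγ.continuousOn.sub hδ.continuousOn).mono hsub
  obtain ⟨r, hr, hr0⟩ := intermediate_value_uIcc hcont
    (show (0 : ℝ) ∈ uIcc _ _ from mem_uIcc_of_le (sub_nonpos.2 h) (sub_nonneg.2 hlt.le))
  exact hlt.ne' (ha.eqOn hγ hδ (hsub hr) (sub_eq_zero.1 hr0) hs)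

lemma abs_integralCurve_sub_le (ha : IsSpeed T C K a) (hγ : IsIntegralCurveOn γ a (Icc 0 T)) :
    LipschitzOnWith C γ (Icc 0 T) :=
  (convex_Icc 0 T).lipschitzOnWith_of_nnnorm_hasDerivWithin_le (fun s hs => hγ s hs)
    fun s hs => ha.bound s hs _

/-- Under a one-sided Lipschitz bound on the speed, the distance between two characteristics
grows at most exponentially backward in time. -/
lemma integralCurve_sub_le (ha : IsSpeed T C K a) {κ : ℝ}
    (hκ : ∀ t ∈ Icc 0 T, ∀ x y, x ≤ y → -(κ * (y - x)) ≤ a t y - a t x)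
    (hγ : IsIntegralCurveOn γ a (Icc 0 T)) (hδ : IsIntegralCurveOn δ a (Icc 0 T))
    (hτ : τ ∈ Icc 0 T) (h : γ τ ≤ δ τ) :
    δ 0 - γ 0 ≤ exp (κ * τ) * (δ τ - γ τ) := by
  have h0 : (0 : ℝ) ∈ Icc 0 T := ⟨le_rfl, hτ.1.trans hτ.2⟩
  have hder : ∀ s ∈ Icc 0 T, HasDerivWithinAt (fun s => exp (κ * s) * (δ s - γ s))
      (exp (κ * s) * κ * (δ s - γ s) + exp (κ * s) * (a s (δ s) - a s (γ s))) (Icc 0 T) s := by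
    intro s hs
    have he : HasDerivWithinAt (fun s => exp (κ * s)) (exp (κ * s) * κ) (Icc 0 T) s := by
      simpa using (((hasDerivAt_id s).const_mul κ).exp).hasDerivWithinAt
    exact he.mul ((hδ s hs).sub (hγ s hs))
  have hmono : MonotoneOn (fun s => exp (κ * s) * (δ s - γ s)) (Icc 0 T) := by
    refine monotoneOn_of_hasDerivWithinAt_nonneg (convex_Icc 0 T)
      (fun s hs => (hder s hs).continuousWithinAt)
      (fun s hs => (hder s (interior_subset hs)).mono interior_subset) fun s hs => ?_
    have hs' := interior_subset hs
    have := hκ s hs' _ _ (ha.integralCurve_le hγ hδ hτ h hs')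
    have := exp_pos (κ * s)
    nlinarith
  simpa using hmono h0 hτ hτ.1

end IsSpeed

/-- Bounds that are preserved by the transport iteration: `w` is bounded by `B`, and on `[0,T]` it
is nondecreasing and `ℓ`-Lipschitz in space, and `Λ`-Lipschitz in time. -/
structure IsMonotoneProfile (T B ℓ Λ : ℝ) (w : ℝ → ℝ → ℝ) : Prop where
  bound : ∀ t ∈ Icc 0 T, ∀ x, |w t x| ≤ B
  mono : ∀ t ∈ Icc 0 T, Monotone (w t)
  lip_space : ∀ t ∈ Icc 0 T, ∀ x y, |w t x - w t y| ≤ ℓ * |x - y|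
  lip_time : ∀ t ∈ Icc 0 T, ∀ s ∈ Icc 0 T, ∀ x, |w t x - w s x| ≤ Λ * |t - s|

/-- `w` is constant along a characteristic of the speed `a` through every point. -/
def IsTransported (T : ℝ) (a w : ℝ → ℝ → ℝ) : Prop :=
  ∀ t ∈ Icc 0 T, ∀ x, ∃ γ : ℝ → ℝ, γ t = x ∧ IsIntegralCurveOn γ a (Icc 0 T) ∧
    ∀ s ∈ Icc 0 T, w s (γ s) = w t x

lemma IsMonotoneProfile.lipschitzOnWith {T B ℓ Λ : ℝ} {w : ℝ → ℝ → ℝ}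
    (hw : IsMonotoneProfile T B ℓ Λ w) {L : ℝ≥0} (hL : ℓ + Λ ≤ L) (hℓ : 0 ≤ ℓ) (hΛ : 0 ≤ Λ) :
    LipschitzOnWith L (fun p : ℝ × ℝ => w p.1 p.2) (Icc 0 T ×ˢ univ) := by
  refine LipschitzOnWith.of_dist_le_mul fun p hp q hq => ?_
  rw [Real.dist_eq, Prod.dist_eq, Real.dist_eq, Real.dist_eq]
  have h1 := hw.lip_space p.1 hp.1 p.2 q.2
  have h2 := hw.lip_time p.1 hp.1 q.1 hq.1 q.2
  have h3 := abs_sub_le (w p.1 p.2) (w p.1 q.2) (w q.1 q.2)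
  have h4 := le_max_left |p.1 - q.1| |p.2 - q.2|
  have h5 := le_max_right |p.1 - q.1| |p.2 - q.2|
  have h6 := (abs_nonneg _).trans h4
  nlinarith [mul_le_mul_of_nonneg_left h5 hℓ, mul_le_mul_of_nonneg_left h4 hΛ,
    mul_le_mul_of_nonneg_right hL h6]

/-- The linear transport problem with monotone Lipschitz data, solved by characteristics. -/
lemma IsSpeed.exists_isTransported {T : ℝ} {C K : ℝ≥0} {a : ℝ → ℝ → ℝ} (ha : IsSpeed T C K a)
    (hT : 0 ≤ T) {κ B L : ℝ} (hκ0 : 0 ≤ κ) (hL : 0 ≤ L)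
    (hκ : ∀ t ∈ Icc 0 T, ∀ x y, x ≤ y → -(κ * (y - x)) ≤ a t y - a t x)
    {g : ℝ → ℝ} (hg : Monotone g) (hgL : ∀ x y, |g x - g y| ≤ L * |x - y|)
    (hgB : ∀ x, |g x| ≤ B) :
    ∃ w : ℝ → ℝ → ℝ, (∀ x, w 0 x = g x) ∧
      (∀ ℓ Λ : ℝ, L * exp (κ * T) ≤ ℓ → ℓ * C ≤ Λ → IsMonotoneProfile T B ℓ Λ w) ∧
      IsTransported T a w := by
  choose! γ hγx hγ using fun t (ht : t ∈ Icc 0 T) => ha.exists_integralCurve ht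
  have h0 : (0 : ℝ) ∈ Icc 0 T := ⟨le_rfl, hT⟩
  have hconst : ∀ t ∈ Icc 0 T, ∀ x, ∀ s ∈ Icc 0 T, γ s (γ t x s) 0 = γ t x 0 :=
    fun t ht x s hs => ha.eqOn (hγ s hs _) (hγ t ht x) hs (hγx s hs _) h0
  refine ⟨fun t x => g (γ t x 0), fun x => congrArg g (hγx 0 h0 x), fun ℓ Λ hℓ hΛ => ?_,
    fun t ht x => ⟨γ t x, hγx t ht x, hγ t ht x, fun s hs => congrArg g (hconst t ht x s hs)⟩⟩
  have hle : ∀ t ∈ Icc 0 T, ∀ x y, x ≤ y → γ t x 0 ≤ γ t y 0 := fun t ht x y hxy =>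
    ha.integralCurve_le (hγ t ht x) (hγ t ht y) ht (by rwa [hγx t ht, hγx t ht]) h0
  have hspace : ∀ t ∈ Icc 0 T, ∀ x y, |g (γ t x 0) - g (γ t y 0)| ≤ ℓ * |x - y| := by
    intro t ht
    have key : ∀ x y, x ≤ y → |g (γ t x 0) - g (γ t y 0)| ≤ ℓ * |x - y| := fun x y hxy => by
      have h1 := ha.integralCurve_sub_le hκ (hγ t ht x) (hγ t ht y) ht
        (by rwa [hγx t ht, hγx t ht])
      rw [hγx t ht, hγx t ht] at h1
      have h2 := hgL (γ t x 0) (γ t y 0)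
      rw [abs_sub_comm (γ t x 0), abs_of_nonneg (sub_nonneg.2 (hle t ht x y hxy))] at h2
      rw [abs_sub_comm x, abs_of_nonneg (sub_nonneg.2 hxy)]
      have h3 : exp (κ * t) ≤ exp (κ * T) := exp_le_exp.2 (mul_le_mul_of_nonneg_left ht.2 hκ0)
      calc _ ≤ L * (exp (κ * t) * (y - x)) := h2.trans (mul_le_mul_of_nonneg_left h1 hL)
        _ ≤ L * (exp (κ * T) * (y - x)) := by
            have := sub_nonneg.2 hxy
            gcongr
        _ = L * exp (κ * T) * (y - x) := by ring
        _ ≤ ℓ * (y - x) := mul_le_mul_of_nonneg_right hℓ (sub_nonneg.2 hxy)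
    intro x y
    rcases le_total x y with h | h
    · exact key x y h
    · rw [abs_sub_comm, abs_sub_comm x]
      exact key y x h
  have hℓ0 : 0 ≤ ℓ := (mul_nonneg hL (exp_pos _).le).trans hℓ
  refine ⟨fun t _ x => hgB _, fun t ht x y hxy => hg (hle t ht x y hxy), hspace,
    fun t ht s hs x => ?_⟩
  have h1 := hspace s hs (γ t x s) x
  rw [hconst t ht x s hs] at h1
  have h2 := (ha.abs_integralCurve_sub_le (hγ t ht x)).dist_le_mul s hs t ht
  rw [hγx t ht, Real.dist_eq, Real.dist_eq, abs_sub_comm s] at h2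
  calc _ ≤ ℓ * (C * |t - s|) := h1.trans (mul_le_mul_of_nonneg_left h2 hℓ0)
    _ = ℓ * C * |t - s| := by ring
    _ ≤ _ := mul_le_mul_of_nonneg_right hΛ (abs_nonneg _)

/-- A Lipschitz function that is constant along characteristics solves the transport equation
almost everywhere. -/
lemma IsTransported.ae_transport {T : ℝ} {L : ℝ≥0} {a w : ℝ → ℝ → ℝ} (h : IsTransported T a w)
    (hw : LipschitzOnWith L (fun p : ℝ × ℝ => w p.1 p.2) (Icc 0 T ×ˢ univ)) :
    ∀ᵐ p : ℝ × ℝ, p.1 ∈ Ioo 0 T → ∃ ut ux : ℝ,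
      HasDerivAt (fun s => w s p.2) ut p.1 ∧ HasDerivAt (fun y => w p.1 y) ux p.2 ∧
        ut + a p.1 p.2 * ux = 0 := by
  filter_upwards [ae_differentiableAt_of_lipschitzOnWith_strip hw] with p hp hpt
  obtain ⟨t, x⟩ := p
  have hd := hp hpt
  have h1 : DifferentiableAt ℝ (fun s => w s x) t :=
    DifferentiableAt.comp (f := fun s => (s, x)) (g := fun p : ℝ × ℝ => w p.1 p.2) t hd
      (by fun_prop)
  have h2 : DifferentiableAt ℝ (fun y => w t y) x :=
    DifferentiableAt.comp (f := fun y => (t, y)) (g := fun p : ℝ × ℝ => w p.1 p.2) x hd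
      (by fun_prop)
  refine ⟨_, _, h1.hasDerivAt, h2.hasDerivAt, ?_⟩
  have hI := Ioo_subset_Icc_self hpt
  have hnhds : Icc 0 T ∈ nhds t := Icc_mem_nhds hpt.1 hpt.2
  obtain ⟨γ, rfl, hγ, hc⟩ := h t hI x
  have hder := hasDerivAt_along_graph hd ((hγ t hI).hasDerivAt hnhds)
    h1.hasDerivAt h2.hasDerivAt
  refine hder.unique ((hasDerivAt_const t (w t (γ t))).congr_of_eventuallyEq ?_)
  filter_upwards [hnhds] with s hs using hc s hs

/-- The characteristic speed `Σ_j A_{ij} u^j` of the `i`-th equation. -/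
def systemSpeed {M : ℕ} (A : Fin M → Fin M → ℝ) (u : ℝ → ℝ → Fin M → ℝ) (i : Fin M)
    (t x : ℝ) : ℝ :=
  ∑ j, A i j * u t x j

/-- A bound for the slopes of the `i`-th component, propagated through the strictly lower
triangular part of `A`. -/
noncomputable def slopeBound {M : ℕ} (A : Fin M → Fin M → ℝ) (T L : ℝ) (i : Fin M) : ℝ :=
  L * exp ((∑ j : Fin M, if _h : j < i then |A i j| * slopeBound A T L j else 0) * T)
termination_by i.val

lemma slopeBound_nonneg {M : ℕ} (A : Fin M → Fin M → ℝ) (T : ℝ) {L : ℝ} (hL : 0 ≤ L)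
    (i : Fin M) : 0 ≤ slopeBound A T L i := by
  rw [slopeBound]
  positivity

lemma abs_sum_mul_sub_sum_mul_le {ι : Type*} [Fintype ι] {α d : ℝ} {c y z : ι → ℝ}
    (hc : ∑ j, |c j| ≤ α) (hd : 0 ≤ d) (h : ∀ j, |y j - z j| ≤ d) :
    |∑ j, c j * y j - ∑ j, c j * z j| ≤ α * d := by
  rw [← Finset.sum_sub_distrib]
  calc _ ≤ ∑ j, |c j * y j - c j * z j| := Finset.abs_sum_le_sum_abs _ _
    _ ≤ ∑ j, |c j| * d := Finset.sum_le_sum fun j _ => by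
        rw [← mul_sub, abs_mul]
        exact mul_le_mul_of_nonneg_left (h j) (abs_nonneg _)
    _ = (∑ j, |c j|) * d := by rw [Finset.sum_mul]
    _ ≤ α * d := mul_le_mul_of_nonneg_right hc hd

lemma isSpeed_systemSpeed {M : ℕ} {A : Fin M → Fin M → ℝ} {T Λ : ℝ} {α B m : ℝ≥0} {ℓ : Fin M → ℝ}
    {u : ℝ → ℝ → Fin M → ℝ} (hα : ∀ i, ∑ j, |A i j| ≤ α) (hm : ∀ i, ℓ i ≤ m)
    (hu : ∀ i, IsMonotoneProfile T B (ℓ i) Λ fun t x => u t x i) (i : Fin M) :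
    IsSpeed T (α * B) (α * m) (systemSpeed A u i) where
  lipschitz t ht := LipschitzWith.of_dist_le_mul fun x y => by
    rw [Real.dist_eq, NNReal.coe_mul, mul_assoc]
    refine abs_sum_mul_sub_sum_mul_le (hα i) (by positivity) fun j => ?_
    exact ((hu j).lip_space t ht x y).trans (mul_le_mul_of_nonneg_right (hm j) (abs_nonneg _))
  continuousOn x := by
    refine continuousOn_finsetSum _ fun j _ => continuousOn_const.mul ?_
    refine LipschitzOnWith.continuousOn (K := Λ.toNNReal) (LipschitzOnWith.of_dist_le_mul ?_)
    intro t ht s hs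
    exact ((hu j).lip_time t ht s hs x).trans
      (mul_le_mul_of_nonneg_right (Real.le_coe_toNNReal Λ) (abs_nonneg _))
  bound t ht x := by
    have := abs_sum_mul_sub_sum_mul_le (c := A i) (y := u t x) (z := 0) (hα i) B.2 fun j => by
      simpa using (hu j).bound t ht x
    simpa [systemSpeed] using this

lemma neg_le_systemSpeed_sub {M : ℕ} {A : Fin M → Fin M → ℝ}
    (hA : ∀ i j : Fin M, i ≤ j → 0 ≤ A i j) {T B Λ : ℝ} {ℓ : Fin M → ℝ}
    {u : ℝ → ℝ → Fin M → ℝ}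
    (hu : ∀ i, IsMonotoneProfile T B (ℓ i) Λ fun t x => u t x i) (i : Fin M) {t : ℝ}
    (ht : t ∈ Icc 0 T) {x y : ℝ} (hxy : x ≤ y) :
    -((∑ j, if j < i then |A i j| * ℓ j else 0) * (y - x)) ≤
      systemSpeed A u i t y - systemSpeed A u i t x := by
  rw [Finset.sum_mul, ← Finset.sum_neg_distrib, systemSpeed, systemSpeed,
    ← Finset.sum_sub_distrib]
  refine Finset.sum_le_sum fun j _ => ?_
  rw [← mul_sub]
  have hmono : 0 ≤ u t y j - u t x j := sub_nonneg.2 ((hu j).mono t ht hxy)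
  split_ifs with h
  · have h1 := (hu j).lip_space t ht y x
    rw [abs_of_nonneg hmono, abs_of_nonneg (sub_nonneg.2 hxy)] at h1
    have h2 := mul_le_mul_of_nonneg_left h1 (abs_nonneg (A i j))
    have h3 := mul_le_mul_of_nonneg_right (neg_abs_le (A i j)) hmono
    linarith
  · simpa using mul_nonneg (hA i j (not_lt.1 h)) hmono

/-- One step of the transport iteration: freeze the speeds at `u` and transport the data. -/
lemma exists_transport_step {M : ℕ} {A : Fin M → Fin M → ℝ}
    (hA : ∀ i j : Fin M, i ≤ j → 0 ≤ A i j) {T : ℝ} (hT : 0 ≤ T) {u0 : ℝ → Fin M → ℝ}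
    {L : ℝ} (hL : 0 ≤ L) (hu0 : ∀ x y i, |u0 x i - u0 y i| ≤ L * |x - y|)
    {α B m : ℝ≥0} (hu0bd : ∀ x i, |u0 x i| ≤ B) (hu0mono : ∀ i, Monotone fun x => u0 x i)
    (hα : ∀ i, ∑ j, |A i j| ≤ α) (hm : ∀ i, slopeBound A T L i ≤ m)
    {u : ℝ → ℝ → Fin M → ℝ}
    (hu : ∀ i, IsMonotoneProfile T B (slopeBound A T L i) (m * (α * B)) fun t x => u t x i) :
    ∃ w : ℝ → ℝ → Fin M → ℝ, (∀ x, w 0 x = u0 x) ∧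
      (∀ i, IsMonotoneProfile T B (slopeBound A T L i) (m * (α * B)) fun t x => w t x i) ∧
      ∀ i, IsTransported T (systemSpeed A u i) fun t x => w t x i := by
  have key := fun i : Fin M => (isSpeed_systemSpeed hα hm hu i).exists_isTransported hT
    (κ := ∑ j, if j < i then |A i j| * slopeBound A T L j else 0)
    (Finset.sum_nonneg fun j _ => by
      split_ifs
      · exact mul_nonneg (abs_nonneg _) (slopeBound_nonneg A T hL j)
      · exact le_rfl) hL
    (fun t ht x y hxy => neg_le_systemSpeed_sub hA hu i ht hxy) (hu0mono i)
    (fun x y => hu0 x y i) (fun x => hu0bd x i)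
  choose w hw0 hwp hwt using key
  refine ⟨fun t x i => w i t x, fun x => funext fun i => hw0 i x, fun i => ?_, hwt⟩
  refine hwp i _ _ (le_of_eq ?_) ?_
  · conv_rhs => rw [slopeBound]
    simp
  · rw [NNReal.coe_mul]
    exact mul_le_mul_of_nonneg_right (hm i) (by positivity)

/-- The contraction estimate in the time-weighted uniform norm. -/
lemma IsTransported.abs_sub_le {M : ℕ} {A : Fin M → Fin M → ℝ} {i : Fin M} {T D r L₂ : ℝ}
    {C K L₁ α : ℝ≥0} {u v : ℝ → ℝ → Fin M → ℝ} {w z : ℝ → ℝ → ℝ}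
    (hw : IsTransported T (systemSpeed A u i) w) (hu : IsSpeed T C K (systemSpeed A u i))
    {t : ℝ} (ht : t ∈ Icc 0 T)
    (hz : LipschitzOnWith L₁ (fun p : ℝ × ℝ => z p.1 p.2) (Icc 0 t ×ˢ univ))
    (hpde : ∀ᵐ p : ℝ × ℝ, p.1 ∈ Ioo 0 t → ∃ ut ux : ℝ,
      HasDerivAt (fun s => z s p.2) ut p.1 ∧ HasDerivAt (fun y => z p.1 y) ux p.2 ∧
        ut + systemSpeed A v i p.1 p.2 * ux = 0)
    (hv : ∀ s ∈ Icc 0 t, ∀ x y j, |v s x j - v s y j| ≤ L₂ * |x - y|)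
    (hD : 0 ≤ D) (hL₂ : 0 ≤ L₂)
    (huv : ∀ s ∈ Icc 0 t, ∀ x j, |u s x j - v s x j| ≤ D * exp (r * s))
    (hα : ∀ i, ∑ j, |A i j| ≤ α) (hr : 0 < r) (hrα : 2 * (L₁ * α) ≤ r)
    (h0 : ∀ x, w 0 x = z 0 x) (x : ℝ) :
    |w t x - z t x| ≤ D / 2 * exp (r * t) := by
  have hsub : Icc 0 t ⊆ Icc 0 T := Icc_subset_Icc_right ht.2
  obtain ⟨γ, rfl, hγ, hc⟩ := hw t ht x
  rw [← hc 0 ⟨le_rfl, ht.1.trans ht.2⟩, h0, abs_sub_comm]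
  have hmain := abs_sub_le_of_ae_transport ht.1 (K := α * L₂)
    (c := fun s => systemSpeed A u i s (γ s)) (ε := fun s => α * (D * exp (r * s))) hz hpde
    (fun s hs => (hγ s (hsub (Ioo_subset_Icc_self hs))).hasDerivAt
      (Icc_mem_nhds hs.1 (hs.2.trans_le ht.2)))
    ((hu.abs_integralCurve_sub_le hγ).mono hsub) (by fun_prop) (fun s hs h => by
      rw [mul_assoc, ← mul_add]
      refine abs_sum_mul_sub_sum_mul_le (hα i) (by positivity) fun j => ?_
      have hs' := Ioo_subset_Icc_self hs
      have h1 := hv s hs' (γ s) (γ s + h) j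
      rw [sub_add_cancel_left, abs_neg] at h1
      exact (_root_.abs_sub_le _ (v s (γ s) j) _).trans (add_le_add (huv s hs' (γ s) j) h1))
  refine hmain.trans ?_
  have hint : ∫ s in 0..t, (α : ℝ) * (D * exp (r * s)) = α * D * ((exp (r * t) - 1) / r) := by
    rw [intervalIntegral.integral_const_mul, intervalIntegral.integral_const_mul,
      intervalIntegral.integral_comp_mul_left _ hr.ne', integral_exp]
    simp only [mul_zero, exp_zero, smul_eq_mul]
    ring
  rw [hint]
  have hE := (exp_pos (r * t)).le
  calc (L₁ : ℝ) * (α * D * ((exp (r * t) - 1) / r))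
      ≤ L₁ * (α * D * (exp (r * t) / r)) := by gcongr; linarith
    _ = (2 * (L₁ * α)) / r * (D / 2 * exp (r * t)) := by ring
    _ ≤ 1 * (D / 2 * exp (r * t)) := by
        gcongr
        exact (div_le_one hr).2 hrα
    _ = _ := one_mul _

lemma IsMonotoneProfile.of_tendsto {T B ℓ Λ : ℝ} {w : ℕ → ℝ → ℝ → ℝ} {v : ℝ → ℝ → ℝ}
    (hw : ∀ n, IsMonotoneProfile T B ℓ Λ (w n))
    (h : ∀ t ∈ Icc 0 T, ∀ x, Filter.Tendsto (fun n => w n t x) Filter.atTop (nhds (v t x))) :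
    IsMonotoneProfile T B ℓ Λ v where
  bound t ht x := le_of_tendsto' (h t ht x).abs fun n => (hw n).bound t ht x
  mono t ht x y hxy := le_of_tendsto_of_tendsto' (h t ht x) (h t ht y)
    fun n => (hw n).mono t ht hxy
  lip_space t ht x y := le_of_tendsto' ((h t ht x).sub (h t ht y)).abs
    fun n => (hw n).lip_space t ht x y
  lip_time t ht s hs x := le_of_tendsto' ((h t ht x).sub (h s hs x)).abs
    fun n => (hw n).lip_time t ht s hs x

lemma tendsto_div_two_pow_mul (D E : ℝ) :
    Filter.Tendsto (fun n : ℕ => D / 2 ^ n * E) Filter.atTop (nhds 0) := by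
  have h := (tendsto_pow_atTop_nhds_zero_of_lt_one (r := (1 / 2 : ℝ)) (by norm_num)
    (by norm_num)).const_mul (D * E)
  rw [mul_zero] at h
  refine h.congr fun n => ?_
  rw [one_div, inv_pow]
  ring

/-- Existence of a monotone Lipschitz profile transported by its own characteristic speeds. -/
lemma exists_self_transported {M : ℕ} {A : Fin M → Fin M → ℝ}
    (hA : ∀ i j : Fin M, i ≤ j → 0 ≤ A i j) {T : ℝ} (hT : 0 ≤ T) {u0 : ℝ → Fin M → ℝ}
    {L : ℝ} (hL : 0 ≤ L) (hu0 : ∀ x y i, |u0 x i - u0 y i| ≤ L * |x - y|)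
    {α B m : ℝ≥0} (hu0bd : ∀ x i, |u0 x i| ≤ B) (hu0mono : ∀ i, Monotone fun x => u0 x i)
    (hα : ∀ i, ∑ j, |A i j| ≤ α) (hm : ∀ i, slopeBound A T L i ≤ m) :
    ∃ u : ℝ → ℝ → Fin M → ℝ, (∀ x, u 0 x = u0 x) ∧
      (∀ i, IsMonotoneProfile T B (slopeBound A T L i) (m * (α * B)) fun t x => u t x i) ∧
      ∀ i, IsTransported T (systemSpeed A u i) fun t x => u t x i := by
  set P : (ℝ → ℝ → Fin M → ℝ) → Prop := fun u =>
    ∀ i, IsMonotoneProfile T B (slopeBound A T L i) (m * (α * B)) fun t x => u t x i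
  choose! Φ hΦ0 hΦP hΦt using fun (u : ℝ → ℝ → Fin M → ℝ) (hu : P u) =>
    exists_transport_step hA hT hL hu0 hu0bd hu0mono hα hm hu
  set L₁ : ℝ≥0 := m + m * (α * B) with hL₁
  set r : ℝ := 2 * (L₁ * α) + 1 with hr
  have hlip : ∀ {u}, P u → ∀ i, LipschitzOnWith L₁ (fun p : ℝ × ℝ => u p.1 p.2 i)
      (Icc 0 T ×ˢ univ) := fun hu i =>
    (hu i).lipschitzOnWith (by rw [hL₁]; push_cast; linarith [hm i])
      (slopeBound_nonneg A T hL i) (by positivity)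
  have contraction : ∀ {u v : ℝ → ℝ → Fin M → ℝ} {D : ℝ}, P u → P v → 0 ≤ D →
      (∀ t ∈ Icc 0 T, ∀ x j, |u t x j - v t x j| ≤ D * exp (r * t)) →
      ∀ t ∈ Icc 0 T, ∀ x j, |Φ u t x j - Φ v t x j| ≤ D / 2 * exp (r * t) := by
    intro u v D hu hv hD huv t ht x j
    have hsub : Icc 0 t ⊆ Icc 0 T := Icc_subset_Icc_right ht.2
    have hz := (hlip (hΦP v hv) j).mono (prod_mono hsub (subset_refl univ))
    refine (hΦt u hu j).abs_sub_le (z := fun t x => Φ v t x j) (isSpeed_systemSpeed hα hm hu j) ht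
      (v := v) (L₁ := L₁) (L₂ := m) hz ?_
      (fun s hs x y k => ((hv k).lip_space s (hsub hs) x y).trans
        (mul_le_mul_of_nonneg_right (hm k) (abs_nonneg _))) hD m.2
      (fun s hs => huv s (hsub hs)) hα (by positivity) (by linarith)
      (fun x => by rw [hΦ0 u hu, hΦ0 v hv]) x
    filter_upwards [(hΦt v hv j).ae_transport (hlip (hΦP v hv) j)] with p hp hpt
    exact hp ⟨hpt.1, hpt.2.trans_le ht.2⟩
  have hstart : P fun _ x => u0 x := fun i =>
    { bound := fun t _ x => hu0bd x i
      mono := fun t _ => hu0mono i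
      lip_space := fun t _ x y => (hu0 x y i).trans <| by
        refine mul_le_mul_of_nonneg_right ?_ (abs_nonneg _)
        rw [slopeBound]
        refine le_mul_of_one_le_right hL (one_le_exp (mul_nonneg (Finset.sum_nonneg ?_) hT))
        intro j _
        split_ifs
        · exact mul_nonneg (abs_nonneg _) (slopeBound_nonneg A T hL j)
        · exact le_rfl
      lip_time := fun t _ s _ x => by
        rw [sub_self, abs_zero]
        positivity }
  set U : ℕ → ℝ → ℝ → Fin M → ℝ := fun n => Φ^[n] fun _ x => u0 x
  have hUsucc : ∀ n, U (n + 1) = Φ (U n) := fun n => Function.iterate_succ_apply' Φ n _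
  have hUP : ∀ n, P (U n) := fun n => by
    induction n with
    | zero => exact hstart
    | succ n ih => rw [hUsucc]; exact hΦP _ ih
  have hUdist : ∀ n, ∀ t ∈ Icc 0 T, ∀ x j,
      |U n t x j - U (n + 1) t x j| ≤ 2 * B / 2 ^ n * exp (r * t) := by
    intro n
    induction n with
    | zero =>
      intro t ht x j
      have h1 := (hUP 0 j).bound t ht x
      have h2 := (hUP 1 j).bound t ht x
      have h3 : (1 : ℝ) ≤ exp (r * t) := one_le_exp (mul_nonneg (by positivity) ht.1)
      have h4 := abs_sub (U 0 t x j) (U (0 + 1) t x j)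
      have h5 : (0 : ℝ) ≤ B := B.2
      simp only [zero_add, pow_zero, div_one] at h4 ⊢
      nlinarith
    | succ n ih =>
      intro t ht x j
      rw [hUsucc n, hUsucc (n + 1), pow_succ, ← div_div]
      exact contraction (hUP n) (hUP (n + 1)) (by positivity) ih t ht x j
  have hUgeom : ∀ t ∈ Icc 0 T, ∀ x j n,
      dist (U n t x j) (U (n + 1) t x j) ≤ 4 * B * exp (r * t) / 2 / 2 ^ n := by
    intro t ht x j n
    rw [Real.dist_eq]
    refine (hUdist n t ht x j).trans (le_of_eq ?_)
    ring
  choose! V hV using fun t (ht : t ∈ Icc 0 T) x j =>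
    cauchySeq_tendsto_of_complete (cauchySeq_of_le_geometric_two (hUgeom t ht x j))
  have hVP : P V := fun i => IsMonotoneProfile.of_tendsto (fun n => hUP n i)
    fun t ht x => hV t ht x i
  have hUV : ∀ n, ∀ t ∈ Icc 0 T, ∀ x j, |V t x j - U n t x j| ≤ 4 * B / 2 ^ n * exp (r * t) := by
    intro n t ht x j
    rw [abs_sub_comm, ← Real.dist_eq]
    refine (dist_le_of_le_geometric_two_of_tendsto (hUgeom t ht x j) (hV t ht x j) n).trans
      (le_of_eq ?_)
    ring
  have hfix : ∀ t ∈ Icc 0 T, ∀ x, Φ V t x = V t x := by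
    intro t ht x
    funext j
    have hlim : Filter.Tendsto (fun n => U (n + 1) t x j) Filter.atTop (nhds (Φ V t x j)) := by
      rw [tendsto_iff_dist_tendsto_zero]
      refine squeeze_zero (fun _ => dist_nonneg) (fun n => ?_)
        (tendsto_div_two_pow_mul (4 * B / 2) (exp (r * t)))
      rw [dist_comm, Real.dist_eq, hUsucc, div_right_comm]
      exact contraction hVP (hUP n) (by positivity) (hUV n) t ht x j
    exact tendsto_nhds_unique hlim ((hV t ht x j).comp (Filter.tendsto_add_atTop_nat 1))
  refine ⟨Φ V, hΦ0 V hVP, hΦP V hVP, fun i t ht x => ?_⟩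
  obtain ⟨γ, hγx, hγ, hc⟩ := hΦt V hVP i t ht x
  refine ⟨γ, hγx, fun s hs => ?_, hc⟩
  have := hγ s hs
  rwa [systemSpeed, ← hfix s hs, ← systemSpeed] at this

/-- A profile transported by its own speeds is a `W^{1,∞}` solution. -/
lemma isW1infSolution_of_isTransported {M : ℕ} {A : Fin M → Fin M → ℝ} {T : ℝ}
    {u0 : ℝ → Fin M → ℝ} {B Λ : ℝ} {ℓ : Fin M → ℝ} {L : ℝ≥0} (hℓ : ∀ i, 0 ≤ ℓ i) (hΛ : 0 ≤ Λ)
    (hL : ∀ i, ℓ i + Λ ≤ L) {u : ℝ → ℝ → Fin M → ℝ} (hu0 : ∀ x, u 0 x = u0 x)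
    (hu : ∀ i, IsMonotoneProfile T B (ℓ i) Λ fun t x => u t x i)
    (ht : ∀ i, IsTransported T (systemSpeed A u i) fun t x => u t x i) :
    IsW1infSolution M A T u0 u := by
  have hlip := fun i => (hu i).lipschitzOnWith (hL i) (hℓ i) hΛ
  refine ⟨⟨L, LipschitzOnWith.of_dist_le_mul fun p hp q hq => ?_⟩,
    ⟨B, fun t ht x i => (hu i).bound t (Ico_subset_Icc_self ht) x⟩,
    fun i => (ht i).ae_transport (hlip i), hu0⟩
  refine (dist_pi_le_iff (by positivity)).2 fun i => ?_
  exact (hlip i).dist_le_mul p ⟨Ico_subset_Icc_self hp.1, hp.2⟩ q ⟨Ico_subset_Icc_self hq.1, hq.2⟩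

/-- Any `W^{1,∞}` solution agrees with a profile transported by its own speeds. -/
lemma IsW1infSolution.eq_of_isTransported {M : ℕ} {A : Fin M → Fin M → ℝ} {T : ℝ}
    {u0 : ℝ → Fin M → ℝ} {Λ : ℝ} {α B m : ℝ≥0} {ℓ : Fin M → ℝ} {u v : ℝ → ℝ → Fin M → ℝ}
    (hα : ∀ i, ∑ j, |A i j| ≤ α) (hm : ∀ i, ℓ i ≤ m) (hu0 : ∀ x, u 0 x = u0 x)
    (hu : ∀ i, IsMonotoneProfile T B (ℓ i) Λ fun t x => u t x i)
    (hut : ∀ i, IsTransported T (systemSpeed A u i) fun t x => u t x i)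
    (hv : IsW1infSolution M A T u0 v) {t : ℝ} (ht : t ∈ Ico 0 T) (x : ℝ) : v t x = u t x := by
  obtain ⟨⟨L₁, hL₁⟩, ⟨B', hB'⟩, hpde, hv0⟩ := hv
  set r : ℝ := 2 * (L₁ * α) + 1 with hr
  set D : ℝ := B + |B'| with hD
  have hsub : ∀ {s}, s ∈ Icc 0 t → ∀ {q}, q ∈ Icc 0 s → q ∈ Ico 0 T := fun hs _ hq =>
    ⟨hq.1, hq.2.trans_lt (hs.2.trans_lt ht.2)⟩
  have hbound : ∀ n : ℕ, ∀ s ∈ Icc 0 t, ∀ x j,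
      |u s x j - v s x j| ≤ D / 2 ^ n * exp (r * s) := by
    intro n
    induction n with
    | zero =>
      intro s hs x j
      have h1 := (hu j).bound s ⟨hs.1, hs.2.trans ht.2.le⟩ x
      have h2 := (hB' s ⟨hs.1, hs.2.trans_lt ht.2⟩ x j).trans (le_abs_self B')
      have h3 : (1 : ℝ) ≤ exp (r * s) := one_le_exp (mul_nonneg (by positivity) hs.1)
      have h4 := abs_sub (u s x j) (v s x j)
      have h5 : 0 ≤ D := by positivity
      rw [pow_zero, div_one]
      nlinarith
    | succ n ih =>
      intro s hs x j
      rw [pow_succ, ← div_div]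
      refine (hut j).abs_sub_le (z := fun t x => v t x j) (isSpeed_systemSpeed hα hm hu j)
        ⟨hs.1, hs.2.trans ht.2.le⟩ (v := v) (L₁ := L₁) (L₂ := L₁) ?_ ?_ ?_ (by positivity) L₁.2
        (fun q hq => ih q ⟨hq.1, hq.2.trans hs.2⟩) hα (by positivity) (by linarith)
        (fun x => by rw [hu0, hv0]) x
      · refine LipschitzOnWith.of_dist_le_mul fun p hp q hq => ?_
        exact (dist_le_pi_dist _ _ j).trans
          (hL₁.dist_le_mul p ⟨hsub hs hp.1, hp.2⟩ q ⟨hsub hs hq.1, hq.2⟩)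
      · filter_upwards [hpde j] with p hp hps
        exact hp ⟨hps.1, hps.2.trans (hs.2.trans_lt ht.2)⟩
      · intro q hq y z k
        have := (dist_le_pi_dist _ _ k).trans
          (hL₁.dist_le_mul (q, y) ⟨hsub hs hq, mem_univ _⟩ (q, z) ⟨hsub hs hq, mem_univ _⟩)
        simpa [Prod.dist_eq, Real.dist_eq] using this
  funext j
  have h0 := ge_of_tendsto' (tendsto_div_two_pow_mul D (exp (r * t)))
    fun n => hbound n t ⟨ht.1, le_rfl⟩ x j
  exact (sub_eq_zero.1 (abs_nonpos_iff.1 h0)).symm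

/-- Existence and uniqueness of a `W^{1,∞}` solution for the triangular case: `M ≥ 2` and
`A_{ij} ≥ 0` for all `j ≥ i`, with nondecreasing `W^{1,∞}` initial data. -/
theorem triangular_existence_uniqueness (M : ℕ) (hM : 2 ≤ M)
    (A : Fin M → Fin M → ℝ) (hA : ∀ i j : Fin M, i ≤ j → 0 ≤ A i j)
    (T : ℝ) (hT : 0 < T)
    (u0 : ℝ → Fin M → ℝ) (L0 : ℝ≥0) (hu0lip : LipschitzWith L0 u0)
    (B0 : ℝ) (hu0bd : ∀ x i, |u0 x i| ≤ B0)
    (hu0mono : ∀ i, Monotone fun x => u0 x i) :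
    ∃ u : ℝ → ℝ → Fin M → ℝ, IsW1infSolution M A T u0 u ∧
      ∀ v : ℝ → ℝ → Fin M → ℝ, IsW1infSolution M A T u0 v →
        ∀ t ∈ Set.Ico 0 T, ∀ x : ℝ, v t x = u t x := by
  have hbdd : ∀ f : Fin M → ℝ, ∃ c : ℝ≥0, ∀ i, f i ≤ c := fun f =>
    ⟨∑ i, (f i).toNNReal, fun i => (Real.le_coe_toNNReal (f i)).trans <| NNReal.coe_le_coe.2 <|
      Finset.single_le_sum (f := fun i => (f i).toNNReal) (fun _ _ => zero_le) (Finset.mem_univ i)⟩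
  obtain ⟨α, hα⟩ := hbdd fun i => ∑ j, |A i j|
  obtain ⟨m, hm⟩ := hbdd (slopeBound A T L0)
  obtain ⟨u, hu0, hu, hut⟩ := exists_self_transported hA hT.le L0.2
    (fun x y i => (dist_le_pi_dist _ _ i).trans (hu0lip.dist_le_mul x y)) (B := B0.toNNReal)
    (fun x i => (hu0bd x i).trans (Real.le_coe_toNNReal B0)) hu0mono hα hm
  refine ⟨u, isW1infSolution_of_isTransported (L := m + m * (α * B0.toNNReal))
    (slopeBound_nonneg A T L0.2) (by positivity) (fun i => ?_) hu0 hu hut,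
    fun v hv t ht x => hv.eq_of_isTransported hα hm hu0 hu hut ht x⟩
  exact add_le_add (hm i) le_rfl
end

section
/- Let T > 0, ε > 0, M ≥ 1, let a : ℝ^M → ℝ^M be C¹ with bounded derivative, and let u : [0,T) × ℝ → ℝ^M be a C³ function, bounded together with its derivatives up to order two, satisfying pointwise ∂_t u^i − ε ∂_{xx} u^i + a^i(u) ∂_x u^i = 0 on (0,T) × ℝ for each i. If ∂_x u^i(0,x) ≥ 0 for all x ∈ ℝ and all i = 1,…,M, then ∂_x u^i(t,x) ≥ 0 for all (t,x) ∈ [0,T) × ℝ and all i. -/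
open MeasureTheory Real Set

lemma IsLocalMin.zero_le_deriv_deriv {f : ℝ → ℝ} {x : ℝ} (h : IsLocalMin f x)
    (hf : ContinuousAt f x) : 0 ≤ deriv (deriv f) x := by
  by_contra! hneg
  have hmax : IsLocalMax f x := isLocalMax_of_deriv_deriv_neg hneg h.deriv_eq_zero hf
  have hconst : f =ᶠ[nhds x] fun _ => f x := by
    filter_upwards [h, hmax] with y h₁ h₂ using le_antisymm h₂ h₁
  simp [hconst.deriv.deriv_eq] at hneg

/-- If `f` has a minimum over `[a, t]` at the right endpoint `t`, its derivative there is
nonpositive. -/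
lemma HasDerivAt.nonpos_of_le_left {f : ℝ → ℝ} {a t f' : ℝ} (hf : HasDerivAt f f' t)
    (hat : a < t) (hmin : ∀ s ∈ Icc a t, f t ≤ f s) : f' ≤ 0 := by
  by_contra! hpos
  have h := hf.hasDerivWithinAt (s := Iio t)
  rw [hasDerivWithinAt_iff_tendsto_slope' (by simp)] at h
  have h₁ := h.eventually (lt_mem_nhds hpos)
  obtain ⟨s, hs, hst⟩ := (h₁.and (Ioo_mem_nhdsLT hat)).exists
  rw [slope_def_field] at hs
  have := hmin s ⟨hst.1.le, hst.2.le⟩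
  exact absurd hs (not_lt.2 (div_nonpos_of_nonneg_of_nonpos (by linarith) (by linarith [hst.2])))

/-- The derivative conditions at a negative interior minimum of
`e^{-(K + A + 2ε + 1) t} w + d (1 + x²)` are incompatible with the equation for `w`. Here `e` is the
exponential factor and `w₀, wt, wx, wxx` are the values of `w` and its derivatives. -/
lemma barrier_inequality_false {ε A K d e x b c w₀ wt wx wxx : ℝ} (hε : 0 < ε) (hd : 0 < d)
    (hb : |b| ≤ A) (hc : |c| ≤ K)
    (heq : wt - ε * wxx + b * wx + c * w₀ = 0)
    (hx : e * wx + d * (2 * x) = 0) (hxx : 0 ≤ e * wxx + d * 2)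
    (ht : e * -(K + A + 2 * ε + 1) * w₀ + e * wt ≤ 0)
    (hneg : e * w₀ < -(d * (1 + x ^ 2))) : False := by
  have hA := (abs_nonneg _).trans hb
  have hbx : -(A * (1 + x ^ 2)) ≤ b * (2 * x) := by
    have h₁ : |b * (2 * x)| ≤ A * (1 + x ^ 2) := by
      rw [abs_mul]
      refine mul_le_mul hb ?_ (abs_nonneg _) hA
      rw [abs_le]
      constructor
      · linarith [sq_nonneg (x + 1)]
      · linarith [sq_nonneg (x - 1)]
    exact (abs_le.1 h₁).1
  have hcK := (abs_le.1 hc).1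
  have hdQ : 0 < d * (1 + x ^ 2) := by positivity
  have h₁ := mul_nonneg hε.le hxx
  have h₂ : d * -(A * (1 + x ^ 2)) ≤ d * (b * (2 * x)) := mul_le_mul_of_nonneg_left hbx hd.le
  have h₃ : 0 ≤ (K + c) * -(e * w₀) := mul_nonneg (by linarith) (by linarith)
  have h₄ : (A + 2 * ε + 1) * (d * (1 + x ^ 2)) ≤ (A + 2 * ε + 1) * -(e * w₀) :=
    mul_le_mul_of_nonneg_left (by linarith) (by linarith)
  have h₅ : 0 ≤ ε * d * x ^ 2 := by positivity
  have hkey : e * wt = ε * (e * wxx) + d * (b * (2 * x)) - c * (e * w₀) := by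
    linear_combination e * heq - b * hx
  linarith

/-- Weak minimum principle for bounded solutions of
`∂_t w - ε ∂_{xx} w + b ∂_x w + c w = 0` on a strip, with `b` and `c` bounded. -/
theorem parabolic_nonneg_of_bounded {T ε B A K : ℝ} (hε : 0 < ε) {w b c w' : ℝ → ℝ → ℝ}
    (hw : ContinuousOn (fun p : ℝ × ℝ => w p.1 p.2) (Ico 0 T ×ˢ univ))
    (hwB : ∀ t ∈ Ico 0 T, ∀ x, |w t x| ≤ B)
    (hw2 : ∀ t ∈ Ioo 0 T, ContDiff ℝ 2 (w t))
    (hw' : ∀ t ∈ Ioo 0 T, ∀ x, HasDerivAt (fun s => w s x) (w' t x) t)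
    (hb : ∀ t ∈ Ioo 0 T, ∀ x, |b t x| ≤ A)
    (hc : ∀ t ∈ Ioo 0 T, ∀ x, |c t x| ≤ K)
    (heq : ∀ t ∈ Ioo 0 T, ∀ x,
      w' t x - ε * deriv (deriv (w t)) x + b t x * deriv (w t) x + c t x * w t x = 0)
    (hinit : ∀ x, 0 ≤ w 0 x) : ∀ t ∈ Ico 0 T, ∀ x, 0 ≤ w t x := by
  intro t₀ ht₀ x₀
  by_contra! hneg
  set l : ℝ := K + A + 2 * ε + 1 with hl
  set e : ℝ → ℝ := fun t => exp (-l * t) with he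
  have hepos : ∀ t, 0 < e t := fun t => exp_pos _
  -- the barrier coefficient
  set d : ℝ := - (e t₀ * w t₀ x₀) / (2 * (1 + x₀ ^ 2)) with hd
  have hdpos : 0 < d := div_pos (by nlinarith [hepos t₀]) (by positivity)
  set z : ℝ → ℝ → ℝ := fun t x => e t * w t x + d * (1 + x ^ 2) with hz
  have hz0 : z t₀ x₀ < 0 := by
    have : d * (1 + x₀ ^ 2) = - (e t₀ * w t₀ x₀) / 2 := by
      rw [hd]; field_simp
    simp only [hz, this]
    nlinarith [hepos t₀]
  have hB0 : 0 ≤ B := (abs_nonneg _).trans (hwB t₀ ht₀ x₀)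
  -- `e` is bounded on `[0, t₀]`
  set E : ℝ := exp (|l| * t₀) with hE
  have heE : ∀ t ∈ Icc 0 t₀, e t ≤ E := fun t ht => by
    refine exp_le_exp.2 ?_
    have h₁ := neg_abs_le l
    have h₂ := abs_nonneg l
    nlinarith [ht.1, ht.2]
  set R : ℝ := |x₀| + E * B / d + 1 with hR
  have hEB : 0 ≤ E * B / d := by positivity
  have hR1 : 1 ≤ R := by have := abs_nonneg x₀; linarith
  have hfar : ∀ t ∈ Icc 0 t₀, ∀ x, R ≤ |x| → 0 < z t x := by
    intro t ht x hx
    have h₁ : -(E * B) ≤ e t * w t x := by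
      have h := (abs_le.1 (hwB t ⟨ht.1, ht.2.trans_lt ht₀.2⟩ x)).1
      nlinarith [heE t ht, hepos t]
    have h₂ : E * B / d < 1 + x ^ 2 := by
      rw [← sq_abs]
      have := abs_nonneg x₀
      nlinarith
    rw [div_lt_iff₀ hdpos] at h₂
    simp only [hz]
    linarith
  have hzc : ContinuousOn (fun p : ℝ × ℝ => z p.1 p.2) (Icc 0 t₀ ×ˢ Icc (-R) R) := by
    have hw₁ : ContinuousOn (fun p : ℝ × ℝ => w p.1 p.2) (Icc 0 t₀ ×ˢ Icc (-R) R) :=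
      hw.mono (prod_mono (fun t ht => ⟨ht.1, ht.2.trans_lt ht₀.2⟩) (subset_univ _))
    simp only [hz, he]
    fun_prop
  have hx₀R : x₀ ∈ Icc (-R) R := abs_le.1 (by linarith)
  have hmem₀ : (t₀, x₀) ∈ Icc 0 t₀ ×ˢ Icc (-R) R := ⟨⟨ht₀.1, le_rfl⟩, hx₀R⟩
  obtain ⟨⟨t, x⟩, ⟨ht, hx⟩, hmin⟩ :=
    (isCompact_Icc.prod isCompact_Icc).exists_isMinOn ⟨_, hmem₀⟩ hzc
  simp only at ht hx
  rw [isMinOn_iff] at hmin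
  have hzneg : z t x < 0 := (hmin _ hmem₀).trans_lt hz0
  have hxR : |x| < R := by
    by_contra! h
    exact (hfar t ht x h).not_gt hzneg
  have htpos : 0 < t := by
    refine ht.1.lt_of_ne ?_
    rintro rfl
    have : 0 ≤ e 0 * w 0 x := mul_nonneg (hepos 0).le (hinit x)
    have : 0 < d * (1 + x ^ 2) := by positivity
    simp only [hz] at hzneg
    linarith
  have htT : t ∈ Ioo 0 T := ⟨htpos, ht.2.trans_lt ht₀.2⟩
  have hzmin : IsLocalMin (z t) x := by
    filter_upwards [Ioo_mem_nhds (abs_lt.1 hxR).1 (abs_lt.1 hxR).2] with y hy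
    exact hmin (t, y) ⟨ht, Ioo_subset_Icc_self hy⟩
  have hwd : Differentiable ℝ (w t) := (hw2 t htT).differentiable (by norm_num)
  have hwd' : Differentiable ℝ (deriv (w t)) :=
    ((contDiff_succ_iff_deriv (n := 1)).1 (hw2 t htT)).2.2.differentiable (by norm_num)
  have hzd (y : ℝ) : HasDerivAt (z t) (e t * deriv (w t) y + d * (2 * y)) y := by
    have h := ((hwd y).hasDerivAt.const_mul (e t)).add
      ((((hasDerivAt_id y).pow 2).const_add 1).const_mul d)
    refine h.congr_deriv ?_
    simp
  have hzd' : deriv (z t) = fun y => e t * deriv (w t) y + d * (2 * y) :=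
    funext fun y => (hzd y).deriv
  have hzdd : deriv (deriv (z t)) x = e t * deriv (deriv (w t)) x + d * 2 := by
    rw [hzd']
    have h := ((hwd' x).hasDerivAt.const_mul (e t)).add
      (((hasDerivAt_id x).const_mul 2).const_mul d)
    exact h.deriv.trans (by ring)
  have hx1 : e t * deriv (w t) x + d * (2 * x) = 0 := (hzd x).deriv ▸ hzmin.deriv_eq_zero
  have hx2 : 0 ≤ e t * deriv (deriv (w t)) x + d * 2 :=
    hzdd ▸ hzmin.zero_le_deriv_deriv (hzd x).continuousAt
  have hed : HasDerivAt e (e t * -l) t := by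
    exact ((hasDerivAt_id t).const_mul (-l)).exp.congr_deriv (by rw [mul_one]; rfl)
  have hzt : HasDerivAt (fun s => z s x) (e t * -l * w t x + e t * w' t x) t :=
    (hed.mul (hw' t htT x)).add_const _
  have ht1 : e t * -l * w t x + e t * w' t x ≤ 0 :=
    hzt.nonpos_of_le_left htpos fun s hs => hmin (s, x) ⟨⟨hs.1, hs.2.trans ht.2⟩, hx⟩
  have hv : e t * w t x < -(d * (1 + x ^ 2)) := by simp only [hz] at hzneg; linarith
  exact barrier_inequality_false hε hdpos (hb t htT x) (hc t htT x) (heq t htT x)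
    hx1 hx2 (by linarith [ht1, hl]) hv

section StripCalculus

variable {f : ℝ × ℝ → ℝ} {t x : ℝ}

lemma HasFDerivAt.hasDerivAt_fst {f' : ℝ × ℝ →L[ℝ] ℝ} (hf : HasFDerivAt f f' (t, x)) :
    HasDerivAt (fun s => f (s, x)) (f' (1, 0)) t :=
  hf.comp_hasDerivAt t ((hasDerivAt_id t).prodMk (hasDerivAt_const t x))

lemma HasFDerivAt.hasDerivAt_snd {f' : ℝ × ℝ →L[ℝ] ℝ} (hf : HasFDerivAt f f' (t, x)) :
    HasDerivAt (fun y => f (t, y)) (f' (0, 1)) x :=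
  hf.comp_hasDerivAt x ((hasDerivAt_const x t).prodMk (hasDerivAt_id x))

lemma ContDiffOn.continuousOn_deriv_snd {T : ℝ}
    (hf : ContDiffOn ℝ 1 f (Ico 0 T ×ˢ univ)) :
    ContinuousOn (fun p : ℝ × ℝ => deriv (fun y => f (p.1, y)) p.2) (Ico 0 T ×ˢ univ) := by
  have hS : UniqueDiffOn ℝ (Ico 0 T ×ˢ (univ : Set ℝ)) :=
    (uniqueDiffOn_Ico 0 T).prod uniqueDiffOn_univ
  refine ((hf.continuousOn_fderivWithin hS le_rfl).clm_apply
    (continuousOn_const (c := ((0, 1) : ℝ × ℝ)))).congr ?_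
  rintro ⟨t, x⟩ hp
  refine HasDerivAt.deriv ?_
  exact ((hf.differentiableOn one_ne_zero) _ hp).hasFDerivWithinAt.comp_hasDerivAt x
    ((hasDerivAt_const x t).prodMk (hasDerivAt_id x)) (.of_forall fun y => ⟨hp.1, mem_univ _⟩)

/-- The mixed partial derivatives of a `C²` function of two variables exist and agree. -/
lemma ContDiffAt.hasDerivAt_deriv_snd (hf : ContDiffAt ℝ 2 f (t, x)) :
    HasDerivAt (fun s => deriv (fun y => f (s, y)) x)
      (deriv (fun y => deriv (fun s => f (s, y)) t) x) t := by
  have hdiff : ∀ᶠ p in nhds (t, x), DifferentiableAt ℝ f p :=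
    (hf.eventually (by simp)).mono fun p hp => hp.differentiableAt (by norm_num)
  have hD : HasFDerivAt (fderiv ℝ f) (fderiv ℝ (fderiv ℝ f) (t, x)) (t, x) :=
    ((hf.fderiv_right (m := 1) (by norm_num)).differentiableAt one_ne_zero).hasFDerivAt
  have hsymm : IsSymmSndFDerivAt ℝ f (t, x) := hf.isSymmSndFDerivAt (by simp)
  have ht : (fun s => deriv (fun y => f (s, y)) x) =ᶠ[nhds t]
      fun s => fderiv ℝ f (s, x) (0, 1) := by
    have hc : ContinuousAt (fun s : ℝ => (s, x)) t := by fun_prop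
    filter_upwards [hc.eventually hdiff] with s hs using hs.hasFDerivAt.hasDerivAt_snd.deriv
  have hx : (fun y => deriv (fun s => f (s, y)) t) =ᶠ[nhds x]
      fun y => fderiv ℝ f (t, y) (1, 0) := by
    have hc : ContinuousAt (fun y : ℝ => (t, y)) x := by fun_prop
    filter_upwards [hc.eventually hdiff] with y hy using hy.hasFDerivAt.hasDerivAt_fst.deriv
  have h₁ := (hD.clm_apply (hasFDerivAt_const ((0, 1) : ℝ × ℝ) (t, x))).hasDerivAt_fst
  have h₂ := (hD.clm_apply (hasFDerivAt_const ((1, 0) : ℝ × ℝ) (t, x))).hasDerivAt_snd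
  rw [hx.deriv_eq, h₂.deriv]
  refine (h₁.congr_of_eventuallyEq ht).congr_deriv ?_
  simpa using hsymm (1, 0) (0, 1)

end StripCalculus

/-- Monotonicity preservation for the viscous regularization of the diagonal system: if `u` is
a `C³` classical solution of `∂_t u^i - ε ∂_{xx} u^i + a^i(u) ∂_x u^i = 0` on `(0,T) × ℝ`,
bounded together with its derivatives up to order two, with `a` of class `C¹` with bounded
derivative, and if `∂_x u^i(0,·) ≥ 0` for all `i`, then `∂_x u^i(t,·) ≥ 0` for all
`t ∈ [0,T)` and all `i`. -/
theorem viscous_monotonicity_preservation (T ε : ℝ) (hT : 0 < T) (hε : 0 < ε)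
    (M : ℕ) (hM : 1 ≤ M)
    (a : (Fin M → ℝ) → Fin M → ℝ) (ha : ContDiff ℝ 1 a)
    (M1 : ℝ) (haD : ∀ v, ‖fderiv ℝ a v‖ ≤ M1)
    (u : ℝ → ℝ → Fin M → ℝ)
    (hreg : ∀ i, ContDiffOn ℝ 3 (fun p : ℝ × ℝ => u p.1 p.2 i)
      (Set.Ico 0 T ×ˢ (Set.univ : Set ℝ)))
    (B : ℝ)
    (hbd : ∀ t ∈ Set.Ico 0 T, ∀ x : ℝ, ∀ i,
      |u t x i| ≤ B ∧
      |deriv (fun y => u t y i) x| ≤ B ∧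
      |deriv (fun s => u s x i) t| ≤ B ∧
      |deriv (deriv (fun y => u t y i)) x| ≤ B ∧
      |deriv (deriv (fun s => u s x i)) t| ≤ B ∧
      |deriv (fun y => deriv (fun s => u s y i) t) x| ≤ B)
    (heq : ∀ t ∈ Set.Ioo 0 T, ∀ x : ℝ, ∀ i,
      deriv (fun s => u s x i) t - ε * deriv (deriv (fun y => u t y i)) x
        + a (u t x) i * deriv (fun y => u t y i) x = 0)
    (hinit : ∀ x : ℝ, ∀ i, 0 ≤ deriv (fun y => u 0 y i) x) :
    ∀ t ∈ Set.Ico 0 T, ∀ x : ℝ, ∀ i, 0 ≤ deriv (fun y => u t y i) x := by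
  have hcd {t : ℝ} (ht : t ∈ Ioo 0 T) (x : ℝ) (i : Fin M) :
      ContDiffAt ℝ 3 (fun p : ℝ × ℝ => u p.1 p.2 i) (t, x) :=
    (hreg i).contDiffAt (prod_mem_nhds (Ico_mem_nhds ht.1 ht.2) Filter.univ_mem)
  have hslice {t : ℝ} (ht : t ∈ Ioo 0 T) (i : Fin M) : ContDiff ℝ 3 fun y => u t y i :=
    contDiff_iff_contDiffAt.2 fun x =>
      (hcd ht x i).comp x (f := fun y => (t, y)) (by fun_prop)
  have hw2 {t : ℝ} (ht : t ∈ Ioo 0 T) (i : Fin M) : ContDiff ℝ 2 (deriv fun y => u t y i) :=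
    ((contDiff_succ_iff_deriv (n := 2)).1 (hslice ht i)).2.2
  have hud {t : ℝ} (ht : t ∈ Ioo 0 T) (x : ℝ) :
      HasDerivAt (u t) (fun j => deriv (fun y => u t y j) x) x :=
    hasDerivAt_pi.2 fun j => ((hslice ht j).differentiable (by norm_num) x).hasDerivAt
  obtain ⟨A, hA⟩ : ∃ A, ∀ v ∈ Metric.closedBall (0 : Fin M → ℝ) B, ‖a v‖ ≤ A :=
    (isCompact_closedBall _ _).exists_bound_of_continuousOn ha.continuous.continuousOn
  intro t₀ ht₀ x₀ i
  have hB0 : 0 ≤ B := (abs_nonneg _).trans (hbd t₀ ht₀ x₀ i).1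
  have hM0 : 0 ≤ M1 := (norm_nonneg _).trans (haD 0)
  refine parabolic_nonneg_of_bounded (K := M1 * B) (A := A) (B := B) hε
    (w := fun t => deriv fun y => u t y i) (b := fun t x => a (u t x) i)
    (c := fun t x => fderiv ℝ a (u t x) (fun j => deriv (fun y => u t y j) x) i)
    (w' := fun t x => deriv (fun y => deriv (fun s => u s y i) t) x)
    ((hreg i).of_le (by norm_num)).continuousOn_deriv_snd
    (fun t ht x => (hbd t ht x i).2.1) (fun t ht => hw2 ht i)
    (fun t ht x => ((hcd ht x i).of_le (by norm_num)).hasDerivAt_deriv_snd)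
    (fun t ht x => ?_) (fun t ht x => ?_) (fun t ht x => ?_) (fun x => hinit x i) t₀ ht₀ x₀
  · refine (norm_le_pi_norm (a (u t x)) i).trans (hA _ ?_)
    rw [mem_closedBall_zero_iff, pi_norm_le_iff_of_nonneg hB0]
    exact fun j => (hbd t (Ioo_subset_Ico_self ht) x j).1
  · refine (norm_le_pi_norm (fderiv ℝ a (u t x) _) i).trans
      (((fderiv ℝ a (u t x)).le_opNorm _).trans ?_)
    refine mul_le_mul (haD _) ?_ (norm_nonneg _) hM0
    rw [pi_norm_le_iff_of_nonneg hB0]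
    exact fun j => (hbd t (Ioo_subset_Ico_self ht) x j).2.1
  · have hux : (fun y => deriv (fun s => u s y i) t) = fun y =>
        ε * deriv (deriv fun y => u t y i) y - a (u t y) i * deriv (fun y => u t y i) y :=
      funext fun y => by linarith [heq t ht y i]
    have hau : HasDerivAt (fun y => a (u t y) i)
        (fderiv ℝ a (u t x) (fun j => deriv (fun y => u t y j) x) i) x :=
      hasDerivAt_pi.1 (((ha.differentiable one_ne_zero (u t x)).hasFDerivAt).comp_hasDerivAt x
        (hud ht x)) i
    have hw := ((hw2 ht i).differentiable (by norm_num) x).hasDerivAt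
    have hww := (((contDiff_succ_iff_deriv (n := 1)).1 (hw2 ht i)).2.2.differentiable
      one_ne_zero x).hasDerivAt
    have hderiv := ((hww.const_mul ε).sub (hau.mul hw)).deriv
    have hrhs : deriv (fun y => deriv (fun s => u s y i) t) x = _ :=
      (congrArg (deriv · x) hux).trans hderiv
    simp only [hrhs]
    ring
end

section
/- Let T > 0, ε > 0, M ≥ 1, let U ⊂ ℝ^M be a closed box, and let a : U → ℝ^M be C¹ with |∂a^i/∂u^j| ≤ M_1 on U for all i, j. Let u : [0,T) × ℝ → ℝ^M be a smooth solution of ∂_t u^i − ε ∂_{xx} u^i + a^i(u) ∂_x u^i = 0 taking values in U, such that w^i := ∂_x u^i ≥ 0 for all i, each w^i(t,·) ∈ L¹(ℝ) ∩ L^∞(ℝ) with sup_{t ∈ [0,T)} Σ_i ‖w^i(t,·)‖_{L¹(ℝ)} =: K < ∞, and with all derivatives of u bounded. Then for all t ∈ (0,T): ∫_ℝ Σ_{i=1}^M f(w^i(t,x)) dx + ∫_0^t ∫_ℝ Σ_{i,j=1}^M (∂a^i/∂u^j)(u(s,x)) w^i(s,x) w^j(s,x) dx ds ≤ ∫_ℝ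 Σ_{i=1}^M f(w^i(0,x)) dx + (1/e) M² M_1 K t. -/
open MeasureTheory Real Set

/-- The entropy function `f(x) = x ln x + 1/e` for `x ≥ 1/e`, and `f(x) = 0` for
`0 ≤ x ≤ 1/e`. -/
noncomputable def fent (x : ℝ) : ℝ :=
  if (Real.exp 1)⁻¹ ≤ x then x * Real.log x + (Real.exp 1)⁻¹ else 0

open Filter Topology

/-- The derivative of the entropy function `fent`. -/
noncomputable def fentDeriv (x : ℝ) : ℝ := Real.log (max x (Real.exp 1)⁻¹) + 1

lemma fentDeriv_of_le {x : ℝ} (h : x ≤ (Real.exp 1)⁻¹) : fentDeriv x = 0 := by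
  simp [fentDeriv, max_eq_right h]

lemma fentDeriv_of_ge {x : ℝ} (h : (Real.exp 1)⁻¹ ≤ x) : fentDeriv x = Real.log x + 1 := by
  simp [fentDeriv, max_eq_left h]

lemma continuous_fentDeriv : Continuous fentDeriv := by
  have hc : 0 < (Real.exp 1)⁻¹ := by positivity
  exact (Continuous.log (by fun_prop) fun x => (lt_max_of_lt_right hc).ne').add continuous_const

lemma fent_of_le {x : ℝ} (h : x ≤ (Real.exp 1)⁻¹) : fent x = 0 := by
  rcases h.lt_or_eq with h | rfl
  · simp [fent, h.not_ge]
  · simp [fent]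

lemma fent_of_ge {x : ℝ} (h : (Real.exp 1)⁻¹ ≤ x) :
    fent x = x * Real.log x + (Real.exp 1)⁻¹ := by
  simp [fent, h]

lemma fent_eq_max (x : ℝ) : fent x =
    max x (Real.exp 1)⁻¹ * Real.log (max x (Real.exp 1)⁻¹) + (Real.exp 1)⁻¹ := by
  rcases le_total x (Real.exp 1)⁻¹ with h | h
  · simp [fent_of_le h, max_eq_right h]
  · simp [fent_of_ge h, max_eq_left h]

lemma continuous_fent : Continuous fent := by
  have h : Continuous fun x : ℝ =>
      max x (Real.exp 1)⁻¹ * Real.log (max x (Real.exp 1)⁻¹) + (Real.exp 1)⁻¹ :=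
    (Real.continuous_mul_log.comp (g := fun y : ℝ => y * Real.log y)
      (f := fun x : ℝ => max x (Real.exp 1)⁻¹) (by fun_prop)).add continuous_const
  exact h.congr fun x => (fent_eq_max x).symm

lemma hasDerivAt_fent (x : ℝ) : HasDerivAt fent (fentDeriv x) x := by
  refine hasDerivAt_of_hasDerivAt_of_ne' (x := (Real.exp 1)⁻¹) (fun y hy => ?_)
    continuous_fent.continuousAt continuous_fentDeriv.continuousAt x
  rcases hy.lt_or_gt with h | h
  · rw [fentDeriv_of_le h.le]
    exact (hasDerivAt_const y (0 : ℝ)).congr_of_eventuallyEq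
      ((eventually_lt_nhds h).mono fun z hz => fent_of_le hz.le)
  · rw [fentDeriv_of_ge h.le]
    have hc : 0 < (Real.exp 1)⁻¹ := by positivity
    exact ((Real.hasDerivAt_mul_log (hc.trans h).ne').add_const _).congr_of_eventuallyEq
      ((eventually_gt_nhds h).mono fun z hz => fent_of_ge hz.le)

lemma fentDeriv_nonneg (x : ℝ) : 0 ≤ fentDeriv x := by
  have h := Real.log_le_log (by positivity) (le_max_right x (Real.exp 1)⁻¹)
  rw [Real.log_inv, Real.log_exp] at h
  unfold fentDeriv
  linarith

lemma fentDeriv_le {x : ℝ} (hx : 0 ≤ x) : fentDeriv x ≤ x := by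
  rcases le_total x (Real.exp 1)⁻¹ with h | h
  · rwa [fentDeriv_of_le h]
  · rw [fentDeriv_of_ge h]
    linarith [Real.log_le_sub_one_of_pos (lt_of_lt_of_le (by positivity) h)]

lemma abs_fentDeriv_le {x : ℝ} (hx : 0 ≤ x) : |fentDeriv x| ≤ x := by
  rw [abs_of_nonneg (fentDeriv_nonneg x)]
  exact fentDeriv_le hx

/-- The tangent line inequality for the convex function `fent`. -/
lemma fentDeriv_mul_sub_le (x y : ℝ) : fentDeriv x * (y - x) ≤ fent y - fent x := by
  have hc : 0 < (Real.exp 1)⁻¹ := by positivity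
  have hm : 0 < max x (Real.exp 1)⁻¹ := lt_max_of_lt_right hc
  have hn : 0 < max y (Real.exp 1)⁻¹ := lt_max_of_lt_right hc
  have key : fentDeriv x * (y - x) ≤
      fentDeriv x * (max y (Real.exp 1)⁻¹ - max x (Real.exp 1)⁻¹) := by
    rcases le_total x (Real.exp 1)⁻¹ with h | h
    · simp [fentDeriv_of_le h]
    · rw [max_eq_left h]
      exact mul_le_mul_of_nonneg_left (by linarith [le_max_left y (Real.exp 1)⁻¹])
        (fentDeriv_nonneg x)
  refine key.trans ?_
  rw [fent_eq_max x, fent_eq_max y, fentDeriv]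
  generalize max x (Real.exp 1)⁻¹ = m at *
  generalize max y (Real.exp 1)⁻¹ = n at *
  have h := Real.log_le_sub_one_of_pos (div_pos hm hn)
  rw [Real.log_div hm.ne' hn.ne'] at h
  have h2 := mul_le_mul_of_nonneg_left h hn.le
  have h3 : n * (m / n - 1) = m - n := by field_simp
  rw [h3] at h2
  linarith

lemma abs_fent_le {x : ℝ} (hx : 0 ≤ x) : |fent x| ≤ x * x := by
  have h1 := fentDeriv_mul_sub_le x 0
  have h2 := fentDeriv_mul_sub_le 0 x
  have hc : 0 ≤ (Real.exp 1)⁻¹ := by positivity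
  rw [fent_of_le hc] at h1 h2
  rw [fentDeriv_of_le hc] at h2
  rw [abs_of_nonneg (by linarith)]
  nlinarith [mul_le_mul_of_nonneg_left (fentDeriv_le hx) hx]

lemma abs_self_sub_le {x : ℝ} (hx : 0 ≤ x) :
    |x - (x * fentDeriv x - fent x)| ≤ (Real.exp 1)⁻¹ := by
  rcases le_total x (Real.exp 1)⁻¹ with h | h
  · rw [fentDeriv_of_le h, fent_of_le h]
    simpa [abs_of_nonneg hx] using h
  · rw [fentDeriv_of_ge h, fent_of_ge h, abs_le]
    have hc : 0 ≤ (Real.exp 1)⁻¹ := by positivity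
    constructor <;> linarith

/-- A function that is smooth on `s`, with all derivatives bounded on `s`. -/
structure SmoothBdd (s : Set (ℝ × ℝ)) (F : ℝ × ℝ → ℝ) : Prop where
  smooth : ContDiffOn ℝ (⊤ : ℕ∞) F s
  bdd : ∀ n : ℕ, ∃ B : ℝ, ∀ p ∈ s, ‖iteratedFDerivWithin ℝ n F s p‖ ≤ B

namespace SmoothBdd

variable {s : Set (ℝ × ℝ)} {F : ℝ × ℝ → ℝ}

lemma exists_abs_le (hF : SmoothBdd s F) : ∃ B, 0 ≤ B ∧ ∀ p ∈ s, |F p| ≤ B := by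
  obtain ⟨B, hB⟩ := hF.bdd 0
  exact ⟨|B|, abs_nonneg B, fun p hp => by
    simpa using (hB p hp).trans (le_abs_self B)⟩

lemma fderivWithin_apply (hF : SmoothBdd s F) (hs : UniqueDiffOn ℝ s) (v : ℝ × ℝ) :
    SmoothBdd s fun p => fderivWithin ℝ F s p v := by
  have h : ContDiffOn ℝ (⊤ : ℕ∞) (fderivWithin ℝ F s) s :=
    hF.smooth.fderivWithin hs (by simp)
  refine ⟨h.clm_apply contDiffOn_const, fun n => ?_⟩
  obtain ⟨B, hB⟩ := hF.bdd (n + 1)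
  refine ⟨‖v‖ * B, fun p hp => (norm_iteratedFDerivWithin_clm_apply_const (h p hp) hs hp
    (by exact_mod_cast le_top)).trans (mul_le_mul_of_nonneg_left ?_ (norm_nonneg _))⟩
  rw [norm_iteratedFDerivWithin_fderivWithin hs hp]
  exact hB p hp

end SmoothBdd

/-- The space-time strip `[0, T) × ℝ`. -/
def strip (T : ℝ) : Set (ℝ × ℝ) := Set.Ico 0 T ×ˢ Set.univ

lemma mem_strip {T t x : ℝ} : (t, x) ∈ strip T ↔ t ∈ Set.Ico 0 T := by simp [strip]

lemma uniqueDiffOn_strip (T : ℝ) : UniqueDiffOn ℝ (strip T) :=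
  (uniqueDiffOn_Ico 0 T).prod uniqueDiffOn_univ

lemma strip_mem_nhds {T t x : ℝ} (ht : t ∈ Set.Ioo 0 T) : strip T ∈ 𝓝 (t, x) :=
  prod_mem_nhds (Ico_mem_nhds ht.1 ht.2) univ_mem

/-- The derivative along the second coordinate. -/
noncomputable def dx (T : ℝ) (F : ℝ × ℝ → ℝ) (p : ℝ × ℝ) : ℝ :=
  fderivWithin ℝ F (strip T) p (0, 1)

/-- The derivative along the first coordinate. -/
noncomputable def dt (T : ℝ) (F : ℝ × ℝ → ℝ) (p : ℝ × ℝ) : ℝ :=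
  fderivWithin ℝ F (strip T) p (1, 0)

namespace SmoothBdd

variable {T : ℝ} {F : ℝ × ℝ → ℝ}

protected lemma dx (hF : SmoothBdd (strip T) F) : SmoothBdd (strip T) (dx T F) :=
  hF.fderivWithin_apply (uniqueDiffOn_strip T) _

protected lemma dt (hF : SmoothBdd (strip T) F) : SmoothBdd (strip T) (dt T F) :=
  hF.fderivWithin_apply (uniqueDiffOn_strip T) _

lemma hasFDerivWithinAt (hF : SmoothBdd (strip T) F) {p : ℝ × ℝ} (hp : p ∈ strip T) :
    HasFDerivWithinAt F (fderivWithin ℝ F (strip T) p) (strip T) p :=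
  ((hF.smooth p hp).differentiableWithinAt (by simp)).hasFDerivWithinAt

lemma hasDerivAt_dx (hF : SmoothBdd (strip T) F) {t : ℝ} (ht : t ∈ Set.Ico 0 T) (x : ℝ) :
    HasDerivAt (fun y => F (t, y)) (dx T F (t, x)) x := by
  rw [← hasDerivWithinAt_univ]
  have h := (hF.hasFDerivWithinAt (mem_strip.2 ht)).comp_hasDerivWithinAt (s := Set.univ) x
    (f := fun y : ℝ => (t, y)) (f' := (0, 1))
    (((hasDerivAt_const x t).prodMk (hasDerivAt_id x)).hasDerivWithinAt)
    (fun y _ => mem_strip.2 ht)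
  exact h

lemma hasDerivAt_dt (hF : SmoothBdd (strip T) F) {t : ℝ} (ht : t ∈ Set.Ioo 0 T) (x : ℝ) :
    HasDerivAt (fun s => F (s, x)) (dt T F (t, x)) t := by
  have h := ((hF.hasFDerivWithinAt (mem_strip.2 ⟨ht.1.le, ht.2⟩)).hasFDerivAt
    (strip_mem_nhds (x := x) ht)).comp_hasDerivAt t
    (f := fun s : ℝ => (s, x)) (f' := (1, 0))
    ((hasDerivAt_id t).prodMk (hasDerivAt_const t x))
  exact h

lemma dt_dx_comm (hF : SmoothBdd (strip T) F) {t : ℝ} (ht : t ∈ Set.Ioo 0 T) (x : ℝ) :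
    dt T (dx T F) (t, x) = dx T (dt T F) (t, x) := by
  have hn := strip_mem_nhds (x := x) ht
  have hc : ContDiffAt ℝ 2 F (t, x) :=
    mod_cast contDiffAt_infty.1 (hF.smooth.contDiffAt hn) 2
  have hsymm : IsSymmSndFDerivAt ℝ F (t, x) := hc.isSymmSndFDerivAt (by simp)
  have hd : DifferentiableAt ℝ (fderiv ℝ F) (t, x) :=
    (hc.fderiv_right (m := 1) (by norm_num)).differentiableAt (by simp)
  have key : ∀ v v' : ℝ × ℝ, fderivWithin ℝ (fun p => fderivWithin ℝ F (strip T) p v)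
      (strip T) (t, x) v' = fderiv ℝ (fderiv ℝ F) (t, x) v' v := by
    intro v v'
    rw [fderivWithin_of_mem_nhds hn]
    have he : (fun p => fderivWithin ℝ F (strip T) p v) =ᶠ[𝓝 (t, x)]
        fun p => fderiv ℝ F p v := by
      filter_upwards [eventually_mem_nhds_iff.2 hn] with p hp
      rw [fderivWithin_of_mem_nhds hp]
    rw [he.fderiv_eq, fderiv_clm_apply hd (differentiableAt_const v)]
    simp
  unfold dt dx
  rw [key, key]
  exact hsymm _ _

lemma continuous_slice (hF : SmoothBdd (strip T) F) {t : ℝ} (ht : t ∈ Set.Ico 0 T) :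
    Continuous fun x => F (t, x) :=
  continuous_iff_continuousAt.2 fun x => (hF.hasDerivAt_dx ht x).continuousAt

end SmoothBdd

lemma abs_sub_le_of_hasDerivAt {f f' : ℝ → ℝ} (hf : ∀ x, HasDerivAt f (f' x) x) {C : ℝ}
    (hC : ∀ x, |f' x| ≤ C) (x y : ℝ) : |f y - f x| ≤ C * |y - x| := by
  simpa using convex_univ.norm_image_sub_le_of_norm_hasDerivWithin_le
    (fun z _ => (hf z).hasDerivWithinAt) (fun z _ => hC z) (mem_univ x) (mem_univ y)

lemma exists_second_difference_eq {v v' v'' : ℝ → ℝ} (hv : ∀ x, HasDerivAt v (v' x) x)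
    (hv' : ∀ x, HasDerivAt v' (v'' x) x) {h : ℝ} (hh : 0 < h) (x : ℝ) :
    ∃ y, |y - x| ≤ h ∧ v (x + h) + v (x - h) - 2 * v x = h ^ 2 * v'' y := by
  have hq : ∀ y, HasDerivAt (fun y => v (y + h) - v y) (v' (y + h) - v' y) y := fun y =>
    ((hv (y + h)).comp_add_const y h).sub (hv y)
  obtain ⟨z, hz, hz'⟩ := exists_hasDerivAt_eq_slope (fun y => v (y + h) - v y)
    (fun y => v' (y + h) - v' y) (a := x - h) (b := x) (by linarith)
    (fun y _ => (hq y).continuousAt.continuousWithinAt) (fun y _ => hq y)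
  obtain ⟨y, hy, hy'⟩ := exists_hasDerivAt_eq_slope v' v'' (a := z) (b := z + h) (by linarith)
    (fun y _ => (hv' y).continuousAt.continuousWithinAt) (fun y _ => hv' y)
  refine ⟨y, abs_le.2 ⟨by linarith [hz.1, hy.1], by linarith [hz.2, hy.2]⟩, ?_⟩
  rw [show x - (x - h) = h by ring, show x - h + h = x by ring, eq_div_iff hh.ne'] at hz'
  rw [show z + h - z = h by ring, eq_div_iff hh.ne'] at hy'
  calc _ = (v' (z + h) - v' z) * h := by rw [hz']; ring
    _ = _ := by rw [← hy']; ring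

lemma integrable_mul_of_abs_le {v k : ℝ → ℝ} (hvi : Integrable v) (hk : Continuous k) {C : ℝ}
    (hC : ∀ x, |k x| ≤ C) : Integrable fun x => v x * k x :=
  hvi.mul_bdd hk.aestronglyMeasurable (Eventually.of_forall hC)

lemma integrable_of_abs_le {v k : ℝ → ℝ} (hvi : Integrable v) (hk : Continuous k)
    (hC : ∀ x, |k x| ≤ v x) : Integrable k :=
  hvi.mono' hk.aestronglyMeasurable (Eventually.of_forall hC)

section Slice

variable {v v' v'' : ℝ → ℝ} (hv0 : ∀ x, 0 ≤ v x) (hvi : Integrable v)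
  (hv : ∀ x, HasDerivAt v (v' x) x)

include hv0 hvi hv

lemma integrable_fentDeriv_comp : Integrable fun x => fentDeriv (v x) :=
  integrable_of_abs_le hvi (continuous_fentDeriv.comp
    (continuous_iff_continuousAt.2 fun x => (hv x).continuousAt)) fun x => abs_fentDeriv_le (hv0 x)

lemma integrable_fent_comp {C : ℝ} (hC : ∀ x, |v x| ≤ C) : Integrable fun x => fent (v x) := by
  have hvc : Continuous v := continuous_iff_continuousAt.2 fun x => (hv x).continuousAt
  exact (integrable_mul_of_abs_le hvi hvc hC).mono'
    (continuous_fent.comp hvc).aestronglyMeasurable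
    (Eventually.of_forall fun x => abs_fent_le (hv0 x))

/-- Diffusion does not increase the entropy. -/
lemma integral_fentDeriv_mul_snd_deriv_nonpos {v''' : ℝ → ℝ} {B C : ℝ}
    (hv' : ∀ x, HasDerivAt v' (v'' x) x) (hv'' : ∀ x, HasDerivAt v'' (v''' x) x)
    (hBv : ∀ x, |v x| ≤ B) (hB : ∀ x, |v'' x| ≤ B) (hC : ∀ x, |v''' x| ≤ C) :
    ∫ x, fentDeriv (v x) * v'' x ≤ 0 := by
  have hvc : Continuous v := continuous_iff_continuousAt.2 fun x => (hv x).continuousAt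
  have hgi := integrable_fentDeriv_comp hv0 hvi hv
  have hgv := integrable_mul_of_abs_le hgi
    (continuous_iff_continuousAt.2 fun x => (hv'' x).continuousAt) hB
  have hfi := integrable_fent_comp hv0 hvi hv hBv
  have hC0 : 0 ≤ C := (abs_nonneg _).trans (hC 0)
  have key : ∀ h > 0, ∫ x, fentDeriv (v x) * v'' x ≤ h * (C * ∫ x, fentDeriv (v x)) := by
    intro h hh
    have hpt : ∀ x, h ^ 2 * (fentDeriv (v x) * v'' x) ≤
        (fent (v (x + h)) + fent (v (x - h)) - 2 * fent (v x)) +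
          h ^ 2 * (h * (C * fentDeriv (v x))) := by
      intro x
      obtain ⟨y, hy, hy'⟩ := exists_second_difference_eq hv hv' hh x
      have h1 := fentDeriv_mul_sub_le (v x) (v (x + h))
      have h2 := fentDeriv_mul_sub_le (v x) (v (x - h))
      have h3 : v'' x ≤ v'' y + C * h := by
        have h4 := (abs_le.1 (abs_sub_le_of_hasDerivAt hv'' hC x y)).1
        have h5 := mul_le_mul_of_nonneg_left hy hC0
        linarith
      have h6 := mul_le_mul_of_nonneg_left h3
        (mul_nonneg (fentDeriv_nonneg (v x)) (sq_nonneg h))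
      have h7 : fentDeriv (v x) * (h ^ 2 * v'' y) =
        fentDeriv (v x) * (v (x + h) - v x) + fentDeriv (v x) * (v (x - h) - v x) := by
        rw [← hy']; ring
      nlinarith
    have hp : Integrable fun x => fent (v (x + h)) := hfi.comp_add_right h
    have hm : Integrable fun x => fent (v (x - h)) := hfi.comp_sub_right h
    have hpm : Integrable fun x => fent (v (x + h)) + fent (v (x - h)) := hp.add hm
    have hΔ : Integrable fun x => fent (v (x + h)) + fent (v (x - h)) - 2 * fent (v x) :=
      hpm.sub (hfi.const_mul 2)
    have hR := ((hgi.const_mul C).const_mul h).const_mul (h ^ 2)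
    have hint := integral_mono (hgv.const_mul (h ^ 2)) (hΔ.add hR) hpt
    simp only [Pi.add_apply] at hint
    rw [integral_add hΔ hR, integral_sub hpm (hfi.const_mul 2), integral_add hp hm,
      integral_add_right_eq_self (fun x => fent (v x)) h,
      integral_sub_right_eq_self (fun x => fent (v x)) h, integral_const_mul, integral_const_mul,
      integral_const_mul, integral_const_mul, integral_const_mul] at hint
    have h2 : 0 < h ^ 2 := by positivity
    refine le_of_mul_le_mul_left ?_ h2
    linarith
  have hlim : Tendsto (fun h : ℝ => h * (C * ∫ x, fentDeriv (v x))) (𝓝[>] 0) (𝓝 0) := by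
    have : Tendsto (fun h : ℝ => h * (C * ∫ x, fentDeriv (v x))) (𝓝 0)
        (𝓝 (0 * (C * ∫ x, fentDeriv (v x)))) := by
      exact (continuous_id.mul continuous_const).tendsto _
    rw [zero_mul] at this
    exact this.mono_left nhdsWithin_le_nhds
  exact ge_of_tendsto hlim (eventually_mem_nhdsWithin.mono fun h hh => key h hh)

/-- The contribution of the transport term to the entropy balance. -/
lemma integral_fentDeriv_mul_transport {b b' : ℝ → ℝ} {B : ℝ}
    (hb : ∀ x, HasDerivAt b (b' x) x) (hv'c : Continuous v') (hb'c : Continuous b')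
    (hBv : ∀ x, |v x| ≤ B) (hBv' : ∀ x, |v' x| ≤ B) (hBb : ∀ x, |b x| ≤ B)
    (hBb' : ∀ x, |b' x| ≤ B) :
    ∫ x, fentDeriv (v x) * (b' x * v x + b x * v' x) =
      ∫ x, b' x * (v x * fentDeriv (v x) - fent (v x)) := by
  have hvc : Continuous v := continuous_iff_continuousAt.2 fun x => (hv x).continuousAt
  have hbc : Continuous b := continuous_iff_continuousAt.2 fun x => (hb x).continuousAt
  have hgi := integrable_fentDeriv_comp hv0 hvi hv
  have hfi := integrable_fent_comp hv0 hvi hv hBv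
  have h1 : Integrable fun x => fent (v x) * b x := integrable_mul_of_abs_le hfi hbc hBb
  have h2 : Integrable fun x => fentDeriv (v x) * v' x * b x :=
    integrable_mul_of_abs_le (integrable_mul_of_abs_le hgi hv'c hBv') hbc hBb
  have h3 : Integrable fun x => fent (v x) * b' x := integrable_mul_of_abs_le hfi hb'c hBb'
  have h4 : Integrable fun x => fentDeriv (v x) * v x * b' x :=
    integrable_mul_of_abs_le (integrable_mul_of_abs_le hgi hvc hBv) hb'c hBb'
  have hzero := integral_eq_zero_of_hasDerivAt_of_integrable
    (fun x => ((hasDerivAt_fent (v x)).comp x (hv x)).mul (hb x)) (h2.add h3) h1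
  have e1 : (fun x => fentDeriv (v x) * (b' x * v x + b x * v' x)) =
      fun x => (fentDeriv (v x) * v' x * b x + fent (v x) * b' x) +
        (fentDeriv (v x) * v x * b' x - fent (v x) * b' x) := by
    funext x; ring
  have e2 : (fun x => b' x * (v x * fentDeriv (v x) - fent (v x))) =
      fun x => fentDeriv (v x) * v x * b' x - fent (v x) * b' x := by
    funext x; ring
  have h5 : Integrable fun x => fentDeriv (v x) * v' x * b x + fent (v x) * b' x := h2.add h3
  have h6 : Integrable fun x => fentDeriv (v x) * v x * b' x - fent (v x) * b' x := h4.sub h3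
  rw [e1, e2, integral_add h5 h6]
  exact add_eq_right.2 hzero

/-- The entropy production at a fixed time. -/
lemma integral_fentDeriv_mul_rhs_le {v''' b b' r : ℝ → ℝ} {ε B L : ℝ} (hε : 0 ≤ ε)
    (hv' : ∀ x, HasDerivAt v' (v'' x) x) (hv'' : ∀ x, HasDerivAt v'' (v''' x) x)
    (hb : ∀ x, HasDerivAt b (b' x) x) (hb'c : Continuous b')
    (hBv : ∀ x, |v x| ≤ B) (hBv' : ∀ x, |v' x| ≤ B) (hBv'' : ∀ x, |v'' x| ≤ B)
    (hBv''' : ∀ x, |v''' x| ≤ B) (hBb : ∀ x, |b x| ≤ B) (hBb' : ∀ x, |b' x| ≤ B)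
    (hr : Integrable r) (hb'r : ∀ x, |b' x| ≤ r x) (hL : ∫ x, r x ≤ L) :
    ∫ x, fentDeriv (v x) * (ε * v'' x - (b' x * v x + b x * v' x)) ≤
      -(∫ x, b' x * v x) + (Real.exp 1)⁻¹ * L := by
  have hvc : Continuous v := continuous_iff_continuousAt.2 fun x => (hv x).continuousAt
  have hv'c : Continuous v' := continuous_iff_continuousAt.2 fun x => (hv' x).continuousAt
  have hv''c : Continuous v'' := continuous_iff_continuousAt.2 fun x => (hv'' x).continuousAt
  have hbc : Continuous b := continuous_iff_continuousAt.2 fun x => (hb x).continuousAt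
  have hgi := integrable_fentDeriv_comp hv0 hvi hv
  have hfi := integrable_fent_comp hv0 hvi hv hBv
  have hdiff := integral_fentDeriv_mul_snd_deriv_nonpos hv0 hvi hv hv' hv'' hBv hBv'' hBv'''
  have h1 : Integrable fun x => fentDeriv (v x) * v'' x := integrable_mul_of_abs_le hgi hv''c hBv''
  have h2 : Integrable fun x => fentDeriv (v x) * (b' x * v x + b x * v' x) := by
    have h3 := integrable_mul_of_abs_le (integrable_mul_of_abs_le hgi hb'c hBb') hvc hBv
    have h4 := integrable_mul_of_abs_le (integrable_mul_of_abs_le hgi hbc hBb) hv'c hBv'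
    refine (h3.add h4).congr (Eventually.of_forall fun x => ?_)
    simp only [Pi.add_apply]
    ring
  have h5 : Integrable fun x => b' x * (v x * fentDeriv (v x) - fent (v x)) := by
    have h6 := integrable_mul_of_abs_le (integrable_mul_of_abs_le hgi hvc hBv) hb'c hBb'
    have h7 := integrable_mul_of_abs_le hfi hb'c hBb'
    refine (h6.sub h7).congr (Eventually.of_forall fun x => ?_)
    simp only [Pi.sub_apply]
    ring
  have h8 : Integrable fun x => b' x * v x :=
    (integrable_mul_of_abs_le hvi hb'c hBb').congr (Eventually.of_forall fun x => mul_comm _ _)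
  have e : (fun x => fentDeriv (v x) * (ε * v'' x - (b' x * v x + b x * v' x))) =
      fun x => ε * (fentDeriv (v x) * v'' x) -
        fentDeriv (v x) * (b' x * v x + b x * v' x) := by
    funext x; ring
  rw [e, integral_sub (h1.const_mul ε) h2, integral_const_mul,
    integral_fentDeriv_mul_transport hv0 hvi hv hb hv'c hb'c hBv hBv' hBb hBb']
  have hmono : ∫ x, b' x * v x ≤
      ∫ x, (b' x * (v x * fentDeriv (v x) - fent (v x)) + (Real.exp 1)⁻¹ * r x) := by
    refine integral_mono h8 (h5.add (hr.const_mul _)) fun x => ?_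
    have h9 : |b' x * (v x - (v x * fentDeriv (v x) - fent (v x)))| ≤ r x * (Real.exp 1)⁻¹ := by
      rw [abs_mul]
      exact mul_le_mul (hb'r x) (abs_self_sub_le (hv0 x)) (abs_nonneg _)
        ((abs_nonneg _).trans (hb'r x))
    have := (abs_le.1 h9).2
    linarith
  rw [integral_add h5 (hr.const_mul _), integral_const_mul] at hmono
  have h10 := mul_nonpos_of_nonneg_of_nonpos hε hdiff
  have h11 := mul_le_mul_of_nonneg_left hL (inv_nonneg.2 (Real.exp_pos 1).le)
  linarith

end Slice

section SpaceTime

variable {T K t : ℝ} {W : ℝ × ℝ → ℝ}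

lemma integrable_prod_of_integral_le {k : ℝ × ℝ → ℝ} {C : ℝ} (ht : t ∈ Set.Ioo 0 T)
    (hWc : ContinuousOn W (strip T)) (hW0 : ∀ p ∈ strip T, 0 ≤ W p)
    (hWi : ∀ s ∈ Set.Ico 0 T, Integrable fun x => W (s, x))
    (hWK : ∀ s ∈ Set.Ico 0 T, ∫ x, W (s, x) ≤ K)
    (hk : ContinuousOn k (strip T)) (hkW : ∀ p ∈ strip T, |k p| ≤ C * W p) :
    Integrable k ((volume.restrict (Set.Ioo 0 t)).prod volume) := by
  have hsub : ∀ s ∈ Set.Ioo 0 t, s ∈ Set.Ico 0 T := fun s hs => ⟨hs.1.le, hs.2.trans ht.2⟩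
  have hsub' : Set.Ioo 0 t ×ˢ (Set.univ : Set ℝ) ⊆ strip T :=
    Set.prod_mono (fun s hs => hsub s hs) subset_rfl
  have hmeas : MeasurableSet (Set.Ioo 0 t ×ˢ (Set.univ : Set ℝ)) :=
    measurableSet_Ioo.prod MeasurableSet.univ
  have hμ : (volume.restrict (Set.Ioo 0 t)).prod (volume : Measure ℝ) =
      ((volume : Measure ℝ).prod volume).restrict (Set.Ioo 0 t ×ˢ Set.univ) := by
    rw [← Measure.prod_restrict, Measure.restrict_univ]
  have hWm : AEStronglyMeasurable W ((volume.restrict (Set.Ioo 0 t)).prod volume) := by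
    rw [hμ]
    exact (hWc.mono hsub').aestronglyMeasurable hmeas
  have hkm : AEStronglyMeasurable k ((volume.restrict (Set.Ioo 0 t)).prod volume) := by
    rw [hμ]
    exact (hk.mono hsub').aestronglyMeasurable hmeas
  have hW : Integrable W ((volume.restrict (Set.Ioo 0 t)).prod volume) := by
    refine (integrable_prod_iff hWm).2 ⟨?_, ?_⟩
    · exact (ae_restrict_mem measurableSet_Ioo).mono fun s hs => hWi s (hsub s hs)
    · refine Integrable.mono' (g := fun _ => K) (integrable_const K)
        hWm.norm.integral_prod_right' ?_
      refine (ae_restrict_mem measurableSet_Ioo).mono fun s hs => ?_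
      have hn : ∀ x, ‖W (s, x)‖ = W (s, x) := fun x =>
        abs_of_nonneg (hW0 _ (mem_strip.2 (hsub s hs)))
      simp only [hn]
      rw [Real.norm_of_nonneg (integral_nonneg fun x => hW0 _ (mem_strip.2 (hsub s hs)))]
      exact hWK s (hsub s hs)
  refine (hW.const_mul C).mono' hkm ?_
  rw [hμ]
  exact (ae_restrict_mem hmeas).mono fun p hp => hkW p (hsub' hp)

lemma ContinuousOn.continuous_strip_slice {k : ℝ × ℝ → ℝ} (hk : ContinuousOn k (strip T)) {s : ℝ}
    (hs : s ∈ Set.Ico 0 T) : Continuous fun x => k (s, x) :=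
  hk.comp_continuous (by fun_prop) fun _ => mem_strip.2 hs

/-- The fundamental theorem of calculus in time for the total entropy. -/
lemma integral_fent_sub (ht : t ∈ Set.Ioo 0 T) (hW : SmoothBdd (strip T) W)
    (hW0 : ∀ p ∈ strip T, 0 ≤ W p) (hWi : ∀ s ∈ Set.Ico 0 T, Integrable fun x => W (s, x))
    (hWK : ∀ s ∈ Set.Ico 0 T, ∫ x, W (s, x) ≤ K) :
    Integrable (fun s => ∫ x, fentDeriv (W (s, x)) * dt T W (s, x))
        (volume.restrict (Set.Ioo 0 t)) ∧
      (∫ x, fent (W (t, x))) - (∫ x, fent (W (0, x))) =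
        ∫ s in Set.Ioo 0 t, ∫ x, fentDeriv (W (s, x)) * dt T W (s, x) := by
  have hT0 : (0 : ℝ) ∈ Set.Ico 0 T := ⟨le_rfl, ht.1.trans ht.2⟩
  have htT : t ∈ Set.Ico 0 T := ⟨ht.1.le, ht.2⟩
  obtain ⟨BW, -, hBW⟩ := hW.exists_abs_le
  obtain ⟨B, -, hB⟩ := hW.dt.exists_abs_le
  have hWc := hW.smooth.continuousOn
  have hk : ContinuousOn (fun p => fentDeriv (W p) * dt T W p) (strip T) :=
    (continuous_fentDeriv.comp_continuousOn hWc).mul hW.dt.smooth.continuousOn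
  have hint : Integrable (fun p => fentDeriv (W p) * dt T W p)
      ((volume.restrict (Set.Ioo 0 t)).prod volume) := by
    refine integrable_prod_of_integral_le (C := B) ht hWc hW0 hWi hWK hk fun p hp => ?_
    rw [abs_mul, mul_comm B]
    exact mul_le_mul (abs_fentDeriv_le (hW0 p hp)) (hB p hp) (abs_nonneg _) (hW0 p hp)
  have hfi : ∀ s ∈ Set.Ico 0 T, Integrable fun x => fent (W (s, x)) := fun s hs =>
    integrable_fent_comp (fun x => hW0 _ (mem_strip.2 hs)) (hWi s hs) (hW.hasDerivAt_dx hs)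
      fun x => hBW _ (mem_strip.2 hs)
  refine ⟨hint.integral_prod_left, ?_⟩
  rw [← integral_sub (hfi t htT) (hfi 0 hT0),
    integral_integral_swap (f := fun s x => fentDeriv (W (s, x)) * dt T W (s, x)) hint]
  refine integral_congr_ae (Eventually.of_forall fun x => ?_)
  have hmaps : Set.MapsTo (fun s : ℝ => (s, x)) (Set.Icc 0 t) (strip T) := fun s hs =>
    mem_strip.2 ⟨hs.1, hs.2.trans_lt ht.2⟩
  have hftc := intervalIntegral.integral_eq_sub_of_hasDerivAt_of_le
    (f := fun s => fent (W (s, x))) (f' := fun s => fentDeriv (W (s, x)) * dt T W (s, x))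
    (a := 0) (b := t) ht.1.le
    (continuous_fent.comp_continuousOn (hWc.comp (by fun_prop) hmaps))
    (fun s hs => HasDerivAt.comp (h := fun s => W (s, x)) s (hasDerivAt_fent (W (s, x)))
      (hW.hasDerivAt_dt ⟨hs.1, hs.2.trans ht.2⟩ x))
    (ContinuousOn.intervalIntegrable (by
      rw [Set.uIcc_of_le ht.1.le]
      exact hk.comp (by fun_prop) hmaps))
  rw [intervalIntegral.integral_of_le ht.1.le, integral_Ioc_eq_integral_Ioo] at hftc
  exact hftc.symm

/-- The entropy inequality for a scalar conservative advection-diffusion equation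
`∂_t W = ε ∂_{xx} W - ∂_x (b W)`, with `b' = ∂_x b`. -/
theorem scalar_entropy_inequality {ε B L : ℝ} {b b' R : ℝ × ℝ → ℝ} (hε : 0 ≤ ε)
    (ht : t ∈ Set.Ioo 0 T) (hW : SmoothBdd (strip T) W)
    (hW0 : ∀ p ∈ strip T, 0 ≤ W p) (hWi : ∀ s ∈ Set.Ico 0 T, Integrable fun x => W (s, x))
    (hWK : ∀ s ∈ Set.Ico 0 T, ∫ x, W (s, x) ≤ K)
    (hb : ∀ s ∈ Set.Ico 0 T, ∀ x, HasDerivAt (fun y => b (s, y)) (b' (s, x)) x)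
    (hb'c : ContinuousOn b' (strip T)) (hBb : ∀ p ∈ strip T, |b p| ≤ B)
    (hBb' : ∀ p ∈ strip T, |b' p| ≤ B)
    (hRi : ∀ s ∈ Set.Ico 0 T, Integrable fun x => R (s, x))
    (hb'R : ∀ p ∈ strip T, |b' p| ≤ R p) (hRL : ∀ s ∈ Set.Ico 0 T, ∫ x, R (s, x) ≤ L)
    (heq : ∀ s ∈ Set.Ioo 0 T, ∀ x, dt T W (s, x) =
      ε * dx T (dx T W) (s, x) - (b' (s, x) * W (s, x) + b (s, x) * dx T W (s, x))) :
    Integrable (fun s => ∫ x, b' (s, x) * W (s, x)) (volume.restrict (Set.Ioo 0 t)) ∧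
      (∫ x, fent (W (t, x))) + (∫ s in Set.Ioo 0 t, ∫ x, b' (s, x) * W (s, x)) ≤
        (∫ x, fent (W (0, x))) + (Real.exp 1)⁻¹ * L * t := by
  obtain ⟨B0, -, hB0⟩ := hW.exists_abs_le
  obtain ⟨B1, -, hB1⟩ := hW.dx.exists_abs_le
  obtain ⟨B2, -, hB2⟩ := hW.dx.dx.exists_abs_le
  obtain ⟨B3, -, hB3⟩ := hW.dx.dx.dx.exists_abs_le
  obtain ⟨C, hC0, hC1, hC2, hC3, hCB⟩ : ∃ C, B0 ≤ C ∧ B1 ≤ C ∧ B2 ≤ C ∧ B3 ≤ C ∧ B ≤ C :=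
    ⟨max B0 (max B1 (max B2 (max B3 B))), by simp⟩
  have hWc := hW.smooth.continuousOn
  have hQi : Integrable (fun s => ∫ x, b' (s, x) * W (s, x))
      (volume.restrict (Set.Ioo 0 t)) := by
    refine Integrable.integral_prod_left (f := fun p : ℝ × ℝ => b' p * W p)
      (integrable_prod_of_integral_le (C := B) ht hWc hW0 hWi hWK (hb'c.mul hWc) fun p hp => ?_)
    rw [abs_mul, abs_of_nonneg (hW0 p hp)]
    exact mul_le_mul_of_nonneg_right (hBb' p hp) (hW0 p hp)
  refine ⟨hQi, ?_⟩
  obtain ⟨hPi, hP⟩ := integral_fent_sub ht hW hW0 hWi hWK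
  have hslice : ∀ s ∈ Set.Ioo 0 t, ∫ x, fentDeriv (W (s, x)) * dt T W (s, x) ≤
      -(∫ x, b' (s, x) * W (s, x)) + (Real.exp 1)⁻¹ * L := by
    intro s hs
    have hs1 : s ∈ Set.Ioo 0 T := ⟨hs.1, hs.2.trans ht.2⟩
    have hs2 : s ∈ Set.Ico 0 T := ⟨hs1.1.le, hs1.2⟩
    have hmem : ∀ x, (s, x) ∈ strip T := fun x => mem_strip.2 hs2
    simp only [heq s hs1]
    exact integral_fentDeriv_mul_rhs_le (r := fun x => R (s, x)) (B := C)
      (fun x => hW0 _ (hmem x)) (hWi s hs2)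
      (hW.hasDerivAt_dx hs2) hε (hW.dx.hasDerivAt_dx hs2) (hW.dx.dx.hasDerivAt_dx hs2)
      (hb s hs2) (hb'c.continuous_strip_slice hs2) (fun x => (hB0 _ (hmem x)).trans hC0)
      (fun x => (hB1 _ (hmem x)).trans hC1) (fun x => (hB2 _ (hmem x)).trans hC2)
      (fun x => (hB3 _ (hmem x)).trans hC3) (fun x => (hBb _ (hmem x)).trans hCB)
      (fun x => (hBb' _ (hmem x)).trans hCB) (hRi s hs2) (fun x => hb'R _ (hmem x)) (hRL s hs2)
  have hmono := setIntegral_mono_on hPi (hQi.neg.add (integrable_const _)) measurableSet_Ioo hslice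
  simp only [Pi.add_apply, Pi.neg_apply] at hmono
  rw [integral_add hQi.fun_neg (integrable_const _), integral_neg, setIntegral_const, ← hP] at hmono
  simp only [Real.volume_real_Ioo_of_le ht.1.le, sub_zero, smul_eq_mul] at hmono
  linarith

end SpaceTime

lemma clm_apply_eq_sum {M : ℕ} (l : (Fin M → ℝ) →L[ℝ] ℝ) (v : Fin M → ℝ) :
    l v = ∑ j, l (Pi.single j 1) * v j := by
  conv_lhs => rw [← Finset.univ_sum_single v, map_sum]
  refine Finset.sum_congr rfl fun j _ => ?_
  rw [mul_comm, ← smul_eq_mul, ← map_smul, ← Pi.single_smul, smul_eq_mul, mul_one]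

/-- Gradient entropy inequality for the viscous regularization: if `u` is a smooth solution of
`∂_t u^i - ε ∂_{xx} u^i + a^i(u) ∂_x u^i = 0` taking values in a closed box `U`, with
nonnegative spatial gradients `w^i = ∂_x u^i ∈ L¹ ∩ L^∞` satisfying
`sup_t Σ_i ‖w^i(t)‖_{L¹} ≤ K`, all derivatives of `u` bounded, and
`|∂a^i/∂u^j| ≤ M₁` on `U`, then for all `t ∈ (0,T)`:
`∫ Σ_i f(w^i(t)) + ∫_0^t ∫ Σ_{i,j} (∂a^i/∂u^j)(u) w^i w^j ≤ ∫ Σ_i f(w^i(0)) + (1/e) M² M₁ K t`. -/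
theorem gradient_entropy_inequality (T ε : ℝ) (hT : 0 < T) (hε : 0 < ε)
    (M : ℕ) (hM : 1 ≤ M) (α β : Fin M → ℝ) (hαβ : ∀ i, α i ≤ β i)
    (a : (Fin M → ℝ) → Fin M → ℝ) (ha : ContDiff ℝ 1 a)
    (M1 : ℝ)
    (haD : ∀ v : Fin M → ℝ, (∀ i, v i ∈ Set.Icc (α i) (β i)) →
      ∀ i j, |fderiv ℝ (fun z => a z i) v (Pi.single j 1)| ≤ M1)
    (u w : ℝ → ℝ → Fin M → ℝ)
    (hreg : ∀ i, ContDiffOn ℝ (⊤ : ℕ∞) (fun p : ℝ × ℝ => u p.1 p.2 i)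
      (Set.Ico 0 T ×ˢ (Set.univ : Set ℝ)))
    (hU : ∀ t ∈ Set.Ico 0 T, ∀ x : ℝ, ∀ i, u t x i ∈ Set.Icc (α i) (β i))
    (hw : ∀ t ∈ Set.Ico 0 T, ∀ x : ℝ, ∀ i,
      HasDerivAt (fun y => u t y i) (w t x i) x)
    (hwpos : ∀ t ∈ Set.Ico 0 T, ∀ x : ℝ, ∀ i, 0 ≤ w t x i)
    (hwL1 : ∀ t ∈ Set.Ico 0 T, ∀ i, Integrable (fun x => w t x i))
    (Bw : ℝ) (hwLinf : ∀ t ∈ Set.Ico 0 T, ∀ x : ℝ, ∀ i, w t x i ≤ Bw)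
    (K : ℝ) (hK : ∀ t ∈ Set.Ico 0 T, ∑ i, ∫ x, w t x i ≤ K)
    (hderbd : ∀ i, ∀ n : ℕ, ∃ B : ℝ, ∀ p ∈ Set.Ico 0 T ×ˢ (Set.univ : Set ℝ),
      ‖iteratedFDerivWithin ℝ n (fun q : ℝ × ℝ => u q.1 q.2 i)
        (Set.Ico 0 T ×ˢ (Set.univ : Set ℝ)) p‖ ≤ B)
    (heq : ∀ t ∈ Set.Ioo 0 T, ∀ x : ℝ, ∀ i,
      deriv (fun s => u s x i) t - ε * deriv (fun y => w t y i) x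
        + a (u t x) i * w t x i = 0) :
    ∀ t ∈ Set.Ioo 0 T,
      (∫ x, ∑ i, fent (w t x i)) +
        (∫ s in Set.Ioo 0 t, ∫ x, ∑ i, ∑ j,
          fderiv ℝ (fun z => a z i) (u s x) (Pi.single j 1) * w s x i * w s x j) ≤
      (∫ x, ∑ i, fent (w 0 x i)) + (Real.exp 1)⁻¹ * (M : ℝ) ^ 2 * M1 * K * t := by
  intro t ht
  set U : Fin M → ℝ × ℝ → ℝ := fun i p => u p.1 p.2 i
  have hUs : ∀ i, SmoothBdd (strip T) (U i) := fun i => ⟨hreg i, hderbd i⟩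
  have hwW : ∀ s ∈ Set.Ico 0 T, ∀ x i, w s x i = dx T (U i) (s, x) := fun s hs x i =>
    (hw s hs x i).unique ((hUs i).hasDerivAt_dx hs x)
  have hWs : ∀ i, SmoothBdd (strip T) (dx T (U i)) := fun i => (hUs i).dx
  have hUbox : ∀ p ∈ strip T, ∀ i, u p.1 p.2 i ∈ Set.Icc (α i) (β i) := fun p hp i =>
    hU p.1 hp.1 p.2 i
  have haC : ∀ i, ContDiff ℝ 1 fun z => a z i := fun i => contDiff_pi.1 ha i
  set A : Fin M → Fin M → ℝ × ℝ → ℝ := fun i j p =>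
    fderiv ℝ (fun z => a z i) (u p.1 p.2) (Pi.single j 1)
  have huc : ContinuousOn (fun p : ℝ × ℝ => u p.1 p.2) (strip T) :=
    continuousOn_pi.2 fun i => (hUs i).smooth.continuousOn
  have hAc : ∀ i j, ContinuousOn (A i j) (strip T) := fun i j =>
    (((haC i).continuous_fderiv one_ne_zero).comp_continuousOn huc).clm_apply continuousOn_const
  have hAM : ∀ i j, ∀ p ∈ strip T, |A i j p| ≤ M1 := fun i j p hp =>
    haD (u p.1 p.2) (hUbox p hp) i j
  have hM1 : 0 ≤ M1 := (abs_nonneg _).trans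
    (haD α (fun i => ⟨le_rfl, hαβ i⟩) ⟨0, hM⟩ ⟨0, hM⟩)
  have hW0 : ∀ i, ∀ p ∈ strip T, 0 ≤ dx T (U i) p := fun i p hp => by
    rw [← hwW p.1 hp.1 p.2 i]
    exact hwpos p.1 hp.1 p.2 i
  have hWi : ∀ i, ∀ s ∈ Set.Ico 0 T, Integrable fun x => dx T (U i) (s, x) := fun i s hs => by
    simpa only [hwW s hs] using hwL1 s hs i
  have hWsum : ∀ s ∈ Set.Ico 0 T, ∑ i, ∫ x, dx T (U i) (s, x) ≤ K := fun s hs => by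
    simpa only [hwW s hs] using hK s hs
  have hWint0 : ∀ s ∈ Set.Ico 0 T, ∀ i, 0 ≤ ∫ x, dx T (U i) (s, x) := fun s hs i =>
    integral_nonneg fun x => hW0 i _ (mem_strip.2 hs)
  have hT0 : (0 : ℝ) ∈ Set.Ico 0 T := ⟨le_rfl, hT⟩
  have htT : t ∈ Set.Ico 0 T := ⟨ht.1.le, ht.2⟩
  have hK0 : 0 ≤ K := (Finset.sum_nonneg fun i _ => hWint0 0 hT0 i).trans (hWsum 0 hT0)
  have hWK : ∀ i, ∀ s ∈ Set.Ico 0 T, ∫ x, dx T (U i) (s, x) ≤ K := fun i s hs =>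
    (Finset.single_le_sum (fun j _ => hWint0 s hs j) (Finset.mem_univ i)).trans (hWsum s hs)
  have hb : ∀ i, ∀ s ∈ Set.Ico 0 T, ∀ x, HasDerivAt (fun y => a (u s y) i)
      (∑ j, A i j (s, x) * dx T (U j) (s, x)) x := by
    intro i s hs x
    have h1 : HasDerivAt (fun y => u s y) (fun j => dx T (U j) (s, x)) x :=
      hasDerivAt_pi.2 fun j => (hUs j).hasDerivAt_dx hs x
    have h2 := (((haC i).differentiable one_ne_zero) (u s x)).hasFDerivAt.comp_hasDerivAt x h1
    exact h2.congr_deriv (clm_apply_eq_sum _ _)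
  have hb'c : ∀ i, ContinuousOn (fun p => ∑ j, A i j p * dx T (U j) p) (strip T) := fun i =>
    continuousOn_finsetSum _ fun j _ => (hAc i j).mul (hWs j).smooth.continuousOn
  have hb'R : ∀ i, ∀ p ∈ strip T, |∑ j, A i j p * dx T (U j) p| ≤
      M1 * ∑ j, dx T (U j) p := by
    intro i p hp
    rw [Finset.mul_sum]
    refine (Finset.abs_sum_le_sum_abs _ _).trans (Finset.sum_le_sum fun j _ => ?_)
    rw [abs_mul, abs_of_nonneg (hW0 j p hp)]
    exact mul_le_mul_of_nonneg_right (hAM i j p hp) (hW0 j p hp)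
  choose Bd _ hBd using fun i => (hWs i).exists_abs_le
  have hbox : IsCompact (Set.Icc α β) := isCompact_Icc
  have hab : ∀ i, ∃ C, ∀ z ∈ Set.Icc α β, |a z i| ≤ C := fun i =>
    hbox.exists_bound_of_continuousOn (haC i).continuous.continuousOn
  choose Ba hBa using hab
  have hmain : ∀ i, Integrable (fun s => ∫ x, (∑ j, A i j (s, x) * dx T (U j) (s, x)) *
        dx T (U i) (s, x)) (volume.restrict (Set.Ioo 0 t)) ∧
      (∫ x, fent (dx T (U i) (t, x))) + (∫ s in Set.Ioo 0 t, ∫ x,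
        (∑ j, A i j (s, x) * dx T (U j) (s, x)) * dx T (U i) (s, x)) ≤
      (∫ x, fent (dx T (U i) (0, x))) + (Real.exp 1)⁻¹ * (M1 * K) * t := by
    intro i
    refine scalar_entropy_inequality (K := K) (B := max (Ba i) (M1 * ∑ j, Bd j))
      (b := fun p => a (u p.1 p.2) i) (b' := fun p => ∑ j, A i j p * dx T (U j) p)
      (R := fun p => M1 * ∑ j, dx T (U j) p)
      hε.le ht (hWs i) (hW0 i) (hWi i) (hWK i) (hb i) (hb'c i) ?_ ?_ ?_ (hb'R i) ?_ ?_
    · exact fun p hp => (hBa i _ ⟨fun j => (hUbox p hp j).1, fun j => (hUbox p hp j).2⟩).trans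
        (le_max_left _ _)
    · refine fun p hp => (hb'R i p hp).trans (le_trans ?_ (le_max_right _ _))
      exact mul_le_mul_of_nonneg_left
        (Finset.sum_le_sum fun j _ => (le_abs_self _).trans (hBd j p hp)) hM1
    · exact fun s hs => (integrable_finsetSum _ fun j _ => hWi j s hs).const_mul M1
    · intro s hs
      rw [integral_const_mul, integral_finsetSum _ fun j _ => hWi j s hs]
      exact mul_le_mul_of_nonneg_left (hWsum s hs) hM1
    · intro s hs x
      have hs' : s ∈ Set.Ico 0 T := ⟨hs.1.le, hs.2⟩
      rw [(hUs i).dt_dx_comm hs]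
      have hpde : ∀ y, dt T (U i) (s, y) =
          ε * dx T (dx T (U i)) (s, y) - a (u s y) i * dx T (U i) (s, y) := by
        intro y
        have h := heq s hs y i
        simp only [hwW s hs'] at h
        rw [((hUs i).hasDerivAt_dt hs y).deriv, ((hWs i).hasDerivAt_dx hs' y).deriv] at h
        linarith
      refine ((hUs i).dt.hasDerivAt_dx hs' x).unique ?_
      simp only [hpde]
      exact (((hWs i).dx.hasDerivAt_dx hs' x).const_mul ε).sub
        ((hb i s hs' x).mul ((hWs i).hasDerivAt_dx hs' x))
  have hfi : ∀ i, ∀ s ∈ Set.Ico 0 T, Integrable fun x => fent (dx T (U i) (s, x)) :=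
    fun i s hs => integrable_fent_comp (fun x => hW0 i _ (mem_strip.2 hs)) (hWi i s hs)
      ((hWs i).hasDerivAt_dx hs) fun x => hBd i _ (mem_strip.2 hs)
  have hfsum : ∀ s ∈ Set.Ico 0 T, ∫ x, ∑ i, fent (w s x i) =
      ∑ i, ∫ x, fent (dx T (U i) (s, x)) := by
    intro s hs
    simp only [hwW s hs]
    exact integral_finsetSum _ fun i _ => hfi i s hs
  have hbW : ∀ i, ∀ s ∈ Set.Ico 0 T, Integrable fun x =>
      (∑ j, A i j (s, x) * dx T (U j) (s, x)) * dx T (U i) (s, x) := by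
    intro i s hs
    refine (integrable_mul_of_abs_le (hWi i s hs) ((hb'c i).continuous_strip_slice hs)
      (C := M1 * ∑ j, Bd j) fun x => ?_).congr (Eventually.of_forall fun x => mul_comm _ _)
    exact (hb'R i _ (mem_strip.2 hs)).trans (mul_le_mul_of_nonneg_left
      (Finset.sum_le_sum fun j _ => (le_abs_self _).trans (hBd j _ (mem_strip.2 hs))) hM1)
  have hQ : (∫ s in Set.Ioo 0 t, ∫ x, ∑ i, ∑ j,
      fderiv ℝ (fun z => a z i) (u s x) (Pi.single j 1) * w s x i * w s x j) =
      ∑ i, ∫ s in Set.Ioo 0 t, ∫ x,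
        (∑ j, A i j (s, x) * dx T (U j) (s, x)) * dx T (U i) (s, x) := by
    rw [← integral_finsetSum _ fun i _ => (hmain i).1]
    refine setIntegral_congr_fun measurableSet_Ioo fun s hs => ?_
    have hs' : s ∈ Set.Ico 0 T := ⟨hs.1.le, hs.2.trans ht.2⟩
    rw [← integral_finsetSum _ fun i _ => hbW i s hs']
    congr 1
    funext x
    refine Finset.sum_congr rfl fun i _ => ?_
    rw [Finset.sum_mul]
    refine Finset.sum_congr rfl fun j _ => ?_
    rw [hwW s hs', hwW s hs']
    ring
  rw [hfsum t htT, hfsum 0 hT0, hQ, ← Finset.sum_add_distrib]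
  refine (Finset.sum_le_sum fun i _ => (hmain i).2).trans ?_
  rw [Finset.sum_add_distrib, Finset.sum_const, Finset.card_univ, Fintype.card_fin, nsmul_eq_mul]
  refine add_le_add_right ?_ _
  have hM' : (1 : ℝ) ≤ M := by exact_mod_cast hM
  have hnonneg : 0 ≤ (Real.exp 1)⁻¹ * (M1 * K) * t := by
    have := ht.1.le
    positivity
  calc (M : ℝ) * ((Real.exp 1)⁻¹ * (M1 * K) * t)
      ≤ (M : ℝ) ^ 2 * ((Real.exp 1)⁻¹ * (M1 * K) * t) :=
        mul_le_mul_of_nonneg_right (by nlinarith) hnonneg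
    _ = _ := by ring
end

section
/- Let I ⊆ ℝ be a measurable set, and let f, g : I → ℝ be measurable. Define the Luxemburg norms ‖f‖_{EXP(I)} = inf{λ > 0 : ∫_I (e^{|f|/λ} − 1) dx ≤ 1} and ‖g‖_{L log L(I)} = inf{λ > 0 : ∫_I (|g|/λ) ln(1 + |g|/λ) dx ≤ 1}. If ‖f‖_{EXP(I)} < ∞ and ‖g‖_{L log L(I)} < ∞, then the product fg belongs to L¹(I) and ∫_I |f g| dx ≤ 2 ‖f‖_{EXP(I)} ‖g‖_{L log L(I)}. -/
open MeasureTheory Real ENNReal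

/-- The Luxemburg norm of the Orlicz space `EXP(I)`:
`‖f‖_{EXP(I)} = inf {λ > 0 : ∫_I (e^{|f|/λ} - 1) ≤ 1}`, with `inf ∅ = ∞`. -/
noncomputable def expNorm (I : Set ℝ) (f : ℝ → ℝ) : ℝ≥0∞ :=
  sInf {l : ℝ≥0∞ | 0 < l ∧ l ≠ ⊤ ∧
    ∫⁻ x in I, ENNReal.ofReal (Real.exp (|f x| / l.toReal) - 1) ≤ 1}

/-- The Luxemburg norm of the Zygmund space `L log L(I)`:
`‖g‖_{L log L(I)} = inf {λ > 0 : ∫_I (|g|/λ) ln(1 + |g|/λ) ≤ 1}`, with `inf ∅ = ∞`. -/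
noncomputable def llogLNorm (I : Set ℝ) (g : ℝ → ℝ) : ℝ≥0∞ :=
  sInf {l : ℝ≥0∞ | 0 < l ∧ l ≠ ⊤ ∧
    ∫⁻ x in I, ENNReal.ofReal ((|g x| / l.toReal) * Real.log (1 + |g x| / l.toReal)) ≤ 1}

/-- Young's inequality for the (non-conjugate) pair `exp a - 1` and `b * log (1 + b)`. -/
theorem mul_le_exp_sub_one_add_mul_log {a b : ℝ} (ha : 0 ≤ a) (hb : 0 ≤ b) :
    a * b ≤ (Real.exp a - 1) + b * Real.log (1 + b) := by
  rcases le_total b 1 with h | h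
  · have h1 := Real.add_one_le_exp a
    have h2 : 0 ≤ b * Real.log (1 + b) := mul_nonneg hb (Real.log_nonneg (by linarith))
    nlinarith
  · have hb0 : 0 < b := by linarith
    have h1 := Real.add_one_le_exp (a - Real.log b)
    rw [Real.exp_sub, Real.exp_log hb0, le_div_iff₀ hb0] at h1
    have h2 : Real.log b ≤ Real.log (1 + b) := Real.log_le_log hb0 (by linarith)
    nlinarith

theorem lintegral_abs_mul_le_of_modular_le_one {α : Type*} [MeasurableSpace α] {μ : Measure α}
    {f g : α → ℝ} (hf : Measurable f) {l m : ℝ≥0∞}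
    (hl : 0 < l) (hl' : l ≠ ⊤) (hm : 0 < m) (hm' : m ≠ ⊤)
    (hfl : ∫⁻ x, ENNReal.ofReal (Real.exp (|f x| / l.toReal) - 1) ∂μ ≤ 1)
    (hgm : ∫⁻ x, ENNReal.ofReal
      ((|g x| / m.toReal) * Real.log (1 + |g x| / m.toReal)) ∂μ ≤ 1) :
    ∫⁻ x, ENNReal.ofReal |f x * g x| ∂μ ≤ 2 * l * m := by
  have hl0 := ENNReal.toReal_pos hl.ne' hl'
  have hm0 := ENNReal.toReal_pos hm.ne' hm'
  have hpoint (x : α) : ENNReal.ofReal |f x * g x| ≤ (l * m) *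
      (ENNReal.ofReal (Real.exp (|f x| / l.toReal) - 1) +
        ENNReal.ofReal ((|g x| / m.toReal) * Real.log (1 + |g x| / m.toReal))) := by
    have ha : 0 ≤ |f x| / l.toReal := by positivity
    have hb : 0 ≤ |g x| / m.toReal := by positivity
    have h1 : 0 ≤ Real.exp (|f x| / l.toReal) - 1 := by
      linarith [Real.one_le_exp ha]
    have h2 : 0 ≤ (|g x| / m.toReal) * Real.log (1 + |g x| / m.toReal) :=
      mul_nonneg hb (Real.log_nonneg (by linarith))
    rw [← ENNReal.ofReal_add h1 h2, ← ENNReal.ofReal_toReal (ENNReal.mul_ne_top hl' hm'),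
      ← ENNReal.ofReal_mul ENNReal.toReal_nonneg, ENNReal.toReal_mul]
    apply ENNReal.ofReal_le_ofReal
    calc |f x * g x| = (l.toReal * m.toReal) * ((|f x| / l.toReal) * (|g x| / m.toReal)) := by
          rw [abs_mul]; field_simp
      _ ≤ _ := by gcongr; exact mul_le_exp_sub_one_add_mul_log ha hb
  calc ∫⁻ x, ENNReal.ofReal |f x * g x| ∂μ ≤ _ := lintegral_mono hpoint
    _ ≤ l * m * (1 + 1) := by
      rw [lintegral_const_mul' _ _ (ENNReal.mul_ne_top hl' hm'),
        lintegral_add_left (by fun_prop)]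
      gcongr
    _ = 2 * l * m := by ring

theorem ENNReal.le_mul_sInf {a c : ℝ≥0∞} {s : Set ℝ≥0∞} (ha : a ≠ ⊤) (hs : sInf s ≠ ⊤)
    (h : ∀ m ∈ s, c ≤ a * m) : c ≤ a * sInf s := by
  rcases eq_or_ne a 0 with rfl | ha0
  · obtain ⟨m, hm⟩ := Set.nonempty_iff_ne_empty.2
      fun h : s = ∅ => hs (by rw [h, _root_.sInf_empty])
    simpa using h m hm
  · rw [← ENNReal.div_le_iff' ha0 ha]
    exact le_sInf fun m hm => (ENNReal.div_le_iff' ha0 ha).2 (h m hm)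

theorem lintegral_abs_mul_le_expNorm_mul_llogLNorm {I : Set ℝ} {f g : ℝ → ℝ}
    (hf : Measurable f) (hfE : expNorm I f < ⊤) (hgL : llogLNorm I g < ⊤) :
    ∫⁻ x in I, ENNReal.ofReal |f x * g x| ≤ 2 * expNorm I f * llogLNorm I g := by
  refine ENNReal.le_mul_sInf (ENNReal.mul_ne_top (by simp) hfE.ne) hgL.ne ?_
  rintro m ⟨hm, hm', hgm⟩
  rw [mul_right_comm]
  refine ENNReal.le_mul_sInf (ENNReal.mul_ne_top (by simp) hm') hfE.ne ?_
  rintro l ⟨hl, hl', hfl⟩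
  rw [mul_right_comm]
  exact lintegral_abs_mul_le_of_modular_le_one hf hl hl' hm hm' hfl hgm

/-- Generalized Hölder inequality between `EXP(I)` and `L log L(I)`:
if `‖f‖_{EXP(I)} < ∞` and `‖g‖_{L log L(I)} < ∞` then `fg ∈ L¹(I)` and
`∫_I |fg| ≤ 2 ‖f‖_{EXP(I)} ‖g‖_{L log L(I)}`. -/
theorem generalized_holder_EXP_LlogL (I : Set ℝ) (hI : MeasurableSet I)
    (f g : ℝ → ℝ) (hf : Measurable f) (hg : Measurable g)
    (hfE : expNorm I f < ⊤) (hgL : llogLNorm I g < ⊤) :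
    IntegrableOn (fun x => f x * g x) I volume ∧
      ∫ x in I, |f x * g x| ≤ 2 * (expNorm I f).toReal * (llogLNorm I g).toReal := by
  have hle := lintegral_abs_mul_le_expNorm_mul_llogLNorm hf hfE hgL
  have htop : 2 * expNorm I f * llogLNorm I g ≠ ⊤ :=
    ENNReal.mul_ne_top (ENNReal.mul_ne_top (by simp) hfE.ne) hgL.ne
  constructor
  · refine ⟨(hf.mul hg).aestronglyMeasurable, ?_⟩
    rw [hasFiniteIntegral_iff_norm]
    exact hle.trans_lt htop.lt_top
  · rw [integral_eq_lintegral_of_nonneg_ae (Filter.Eventually.of_forall fun x => abs_nonneg _)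
      (by fun_prop)]
    simpa [ENNReal.toReal_mul] using ENNReal.toReal_mono htop hle
end

section
/- Let g ∈ L¹(ℝ) with Luxemburg norm ‖g‖_{L log L(ℝ)} = inf{λ > 0 : ∫_ℝ (|g|/λ) ln(1 + |g|/λ) dx ≤ 1} ≤ K < ∞. Then for every x ∈ ℝ and every h > 0: ∫_x^{x+h} |g(y)| dy ≤ 2K / ln(1 + 1/h). In particular, if u is an absolutely continuous function on ℝ with u' = g, then |u(x+h) − u(x)| ≤ 2K / ln(1 + 1/h) for all x ∈ ℝ, h > 0. -/
open MeasureTheory Real ENNReal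

/-- A Young-type inequality: `a ln(1 + b) ≤ a ln(1 + a) + b` for nonnegative `a`, `b`. -/
theorem mul_log_one_add_le {a b : ℝ} (ha : 0 ≤ a) (hb : 0 ≤ b) :
    a * Real.log (1 + b) ≤ a * Real.log (1 + a) + b := by
  rcases le_total b a with hba | hab
  · have := mul_le_mul_of_nonneg_left
      (Real.log_le_log (by linarith) (by linarith : 1 + b ≤ 1 + a)) ha
    linarith
  · have h1 := Real.log_le_sub_one_of_pos (show 0 < (1 + b) / (1 + a) by positivity)
    rw [Real.log_div (by positivity) (by positivity)] at h1
    have h2 : a * ((1 + b) / (1 + a) - 1) ≤ b := by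
      have h3 : a * ((1 + b) / (1 + a) - 1) = a * (b - a) / (1 + a) := by
        field_simp
        ring
      rw [h3, div_le_iff₀ (by positivity)]
      nlinarith
    nlinarith [mul_le_mul_of_nonneg_left h1 ha]

/-- If the `L log L` modular of `g / l` is at most one, then `∫_x^{x+h} |g| ≤ 2l / ln(1 + 1/h)`. -/
theorem setIntegral_abs_le_of_lintegral_le_one {g : ℝ → ℝ} (hg : Integrable g) {l : ℝ}
    (hl : 0 < l)
    (hmod : ∫⁻ x, ENNReal.ofReal ((|g x| / l) * Real.log (1 + |g x| / l)) ≤ 1)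
    (x : ℝ) {h : ℝ} (hh : 0 < h) :
    ∫ y in Set.Ioc x (x + h), |g y| ≤ 2 * l / Real.log (1 + 1 / h) := by
  have hL : 0 < Real.log (1 + 1 / h) := Real.log_pos (by linarith [one_div_pos.mpr hh])
  set f : ℝ → ℝ := fun y => (|g y| / l) * Real.log (1 + |g y| / l) with hf
  have hf0 : ∀ y, 0 ≤ f y := fun y => by
    have h0 : 0 ≤ |g y| / l := by positivity
    exact mul_nonneg h0 (Real.log_nonneg (by linarith))
  have hgm : AEMeasurable (fun y => |g y| / l) := hg.abs.aemeasurable.div_const l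
  have hfm : AEStronglyMeasurable f :=
    (hgm.mul (Real.measurable_log.comp_aemeasurable (hgm.const_add 1))).aestronglyMeasurable
  have hfi : Integrable f := by
    refine ⟨hfm, ?_⟩
    rw [hasFiniteIntegral_iff_ofReal (Filter.Eventually.of_forall hf0)]
    exact hmod.trans_lt ENNReal.one_lt_top
  have hf1 : ∫ y, f y ≤ 1 := by
    rw [integral_eq_lintegral_of_nonneg_ae (Filter.Eventually.of_forall hf0) hfm]
    exact ENNReal.toReal_le_of_le_ofReal zero_le_one (by simpa using hmod)
  have hfs : ∫ y in Set.Ioc x (x + h), f y ≤ 1 :=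
    (setIntegral_le_integral hfi (Filter.Eventually.of_forall hf0)).trans hf1
  have hc : IntegrableOn (fun _ : ℝ => 1 / h) (Set.Ioc x (x + h)) :=
    integrableOn_const (by simp)
  have key : ∫ y in Set.Ioc x (x + h), |g y| / l * Real.log (1 + 1 / h) ≤
      ∫ y in Set.Ioc x (x + h), (f y + 1 / h) :=
    integral_mono ((hg.abs.div_const l).mul_const _).integrableOn
      (hfi.integrableOn.add hc)
      fun y => mul_log_one_add_le (by positivity) (by positivity)
  rw [integral_add hfi.integrableOn hc, integral_mul_const, integral_div,
    setIntegral_const] at key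
  have hv : volume.real (Set.Ioc x (x + h)) • (1 / h) = 1 := by
    simp [Real.volume_real_Ioc_of_le (show x ≤ x + h by linarith), hh.ne']
  rw [hv] at key
  have key2 : (∫ y in Set.Ioc x (x + h), |g y|) / l * Real.log (1 + 1 / h) ≤ 2 := by linarith
  rw [le_div_iff₀ hL]
  rw [div_mul_eq_mul_div, div_le_iff₀ hl] at key2
  exact key2

/-- If `g ∈ L¹(ℝ)` has Luxemburg `L log L` norm at most `K` (expressed by the fact that every
`λ > K` satisfies the defining integral inequality), then
`∫_x^{x+h} |g| ≤ 2K / ln(1 + 1/h)` for all `x ∈ ℝ`, `h > 0`; consequently any absolutely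
continuous function `u` with `u' = g` satisfies `|u(x+h) - u(x)| ≤ 2K / ln(1 + 1/h)`. -/
theorem llogL_modulus_of_continuity (g : ℝ → ℝ) (K : ℝ) (hK : 0 ≤ K)
    (hg : Integrable g)
    (hnorm : ∀ l : ℝ, K < l →
      ∫⁻ x, ENNReal.ofReal ((|g x| / l) * Real.log (1 + |g x| / l)) ≤ 1) :
    (∀ x h : ℝ, 0 < h →
      ∫ y in Set.Ioc x (x + h), |g y| ≤ 2 * K / Real.log (1 + 1 / h)) ∧
    (∀ u : ℝ → ℝ, (∀ s t : ℝ, s ≤ t → u t - u s = ∫ y in Set.Ioc s t, g y) →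
      ∀ x h : ℝ, 0 < h →
        |u (x + h) - u x| ≤ 2 * K / Real.log (1 + 1 / h)) := by
  have main : ∀ x h : ℝ, 0 < h →
      ∫ y in Set.Ioc x (x + h), |g y| ≤ 2 * K / Real.log (1 + 1 / h) := by
    intro x h hh
    have ht : Filter.Tendsto (fun l : ℝ => 2 * l / Real.log (1 + 1 / h))
        (nhdsWithin K (Set.Ioi K)) (nhds (2 * K / Real.log (1 + 1 / h))) :=
      ((Filter.tendsto_id.const_mul 2).div_const _).mono_left nhdsWithin_le_nhds
    refine ge_of_tendsto ht ?_
    filter_upwards [self_mem_nhdsWithin] with l hl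
    exact setIntegral_abs_le_of_lintegral_le_one hg (hK.trans_lt hl) (hnorm l hl) x hh
  refine ⟨main, fun u hu x h hh => ?_⟩
  rw [hu x (x + h) (by linarith)]
  exact abs_integral_le_integral_abs.trans (main x h hh)
end

section
/- Let I = (a,b) be a bounded open interval and let (u_n) be a sequence of absolutely continuous functions u_n : I → ℝ such that sup_n ( ‖u_n‖_{L¹(I)} + ‖u_n'‖_{L log L(I)} ) < ∞, where ‖g‖_{L log L(I)} = inf{λ > 0 : ∫_I (|g|/λ) ln(1 + |g|/λ) dx ≤ 1}. Then there is a subsequence of (u_n) converging uniformly on I to a continuous function u : I → ℝ. -/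
open MeasureTheory Real ENNReal

/-- A Young-type splitting: a nonnegative number is controlled by a constant plus a small
multiple of its `L log L` density. -/
lemma le_exp_add_mul_log_div {h R : ℝ} (hh : 0 ≤ h) (hR : 0 < R) :
    h ≤ Real.exp R + h * Real.log (1 + h) / R := by
  rcases le_or_gt h (Real.exp R) with hle | hgt
  · have : 0 ≤ h * Real.log (1 + h) / R := by
      have := Real.log_nonneg (by linarith : (1 : ℝ) ≤ 1 + h)
      positivity
    linarith
  · have hlog : R ≤ Real.log (1 + h) := by
      rw [Real.le_log_iff_exp_le (by linarith)]
      linarith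
    have : h ≤ h * Real.log (1 + h) / R := by
      rw [le_div_iff₀ hR]
      gcongr
    linarith [Real.exp_pos R]

/-- Quantitative absolute continuity of the indefinite integral of a function whose Luxemburg
`L log L` norm on `(a, b)` is at most `l`. -/
lemma abs_integral_indicator_le_of_LlogL {a b l R : ℝ} {g : ℝ → ℝ} (hl : 0 < l) (hR : 0 < R)
    (hg : IntegrableOn g (Set.Ioo a b) volume)
    (hgL : ∫⁻ x in Set.Ioo a b,
      ENNReal.ofReal ((|g x| / l) * Real.log (1 + |g x| / l)) ≤ 1) (s t : ℝ) :
    |∫ y in s..t, (Set.Ioo a b).indicator g y| ≤ l * (Real.exp R * |t - s| + 1 / R) := by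
  set Φ : ℝ → ℝ := fun x => (|g x| / l) * Real.log (1 + |g x| / l) with hΦ
  have hΦ0 : ∀ x, 0 ≤ Φ x := fun x => by
    have h0 : 0 ≤ |g x| / l := by positivity
    exact mul_nonneg h0 (Real.log_nonneg (by linarith))
  have hΦm : AEStronglyMeasurable Φ (volume.restrict (Set.Ioo a b)) := by
    have hm : Measurable fun z : ℝ => (|z| / l) * Real.log (1 + |z| / l) := by fun_prop
    exact (hm.comp_aemeasurable hg.aestronglyMeasurable.aemeasurable).aestronglyMeasurable
  have hΦi : IntegrableOn Φ (Set.Ioo a b) volume := by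
    refine ⟨hΦm, ?_⟩
    rw [hasFiniteIntegral_iff_ofReal (Filter.Eventually.of_forall hΦ0)]
    exact hgL.trans_lt ENNReal.one_lt_top
  have hΦ1 : ∫ x in Set.Ioo a b, Φ x ≤ 1 := by
    rw [integral_eq_lintegral_of_nonneg_ae (Filter.Eventually.of_forall hΦ0) hΦm]
    exact ENNReal.toReal_le_of_le_ofReal zero_le_one (by simpa using hgL)
  set Ψ := (Set.Ioo a b).indicator Φ with hΨ
  have hΨi : Integrable Ψ volume := hΦi.integrable_indicator measurableSet_Ioo
  have hΨ0 : ∀ x, 0 ≤ Ψ x := fun x => Set.indicator_nonneg (fun x _ => hΦ0 x) x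
  have hΨ1 : ∫ x in Set.uIoc s t, Ψ x ≤ 1 := by
    refine (setIntegral_le_integral hΨi (Filter.Eventually.of_forall hΨ0)).trans ?_
    rwa [hΨ, integral_indicator measurableSet_Ioo]
  have hpt : ∀ x, |(Set.Ioo a b).indicator g x| ≤ l * (Real.exp R + Ψ x / R) := fun x => by
    by_cases hx : x ∈ Set.Ioo a b
    · have h := le_exp_add_mul_log_div (h := |g x| / l) (by positivity) hR
      rw [div_le_iff₀ hl] at h
      simp only [hΨ, hΦ, Set.indicator_of_mem hx]
      linarith
    · simp only [hΨ, Set.indicator_of_notMem hx]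
      simp only [abs_zero, zero_div, add_zero]
      positivity
  have hconst : IntegrableOn (fun _ : ℝ => Real.exp R) (Set.uIoc s t) volume :=
    integrableOn_const (by simp [Set.uIoc])
  have hΨR : IntegrableOn (fun x => Ψ x / R) (Set.uIoc s t) volume :=
    (hΨi.div_const R).integrableOn
  calc |∫ y in s..t, (Set.Ioo a b).indicator g y|
      ≤ ∫ y in Set.uIoc s t, |(Set.Ioo a b).indicator g y| :=
        by simpa only [Real.norm_eq_abs] using
          intervalIntegral.norm_integral_le_integral_norm_uIoc (μ := volume)
            (f := (Set.Ioo a b).indicator g) (a := s) (b := t)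
    _ ≤ ∫ y in Set.uIoc s t, l * (Real.exp R + Ψ y / R) := by
        refine integral_mono (hg.integrable_indicator measurableSet_Ioo).abs.integrableOn
          ((hconst.add hΨR).const_mul l) hpt
    _ = l * (Real.exp R * |t - s| + (∫ y in Set.uIoc s t, Ψ y) / R) := by
        rw [integral_const_mul, integral_add hconst hΨR, integral_div, setIntegral_const]
        simp [Set.uIoc, Measure.real, abs_sub_comm, max_sub_min_eq_abs, mul_comm]
    _ ≤ l * (Real.exp R * |t - s| + 1 / R) := by gcongr

/-- A uniformly bounded, uniformly equicontinuous sequence of real functions on a compact metric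
space has a uniformly convergent subsequence. -/
lemma exists_subseq_tendstoUniformly {X : Type*} [PseudoMetricSpace X] [CompactSpace X]
    {w : ℕ → X → ℝ} {B : ℝ} (hB : ∀ n x, |w n x| ≤ B) (hw : UniformEquicontinuous w) :
    ∃ φ : ℕ → ℕ, StrictMono φ ∧ ∃ v : X → ℝ, Continuous v ∧
      TendstoUniformly (fun n => w (φ n)) v Filter.atTop := by
  let W : ℕ → BoundedContinuousFunction X ℝ := fun n =>
    BoundedContinuousFunction.mkOfCompact ⟨w n, (hw.uniformContinuous n).continuous⟩
  have hcomp : IsCompact (closure (Set.range W)) := by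
    refine BoundedContinuousFunction.arzela_ascoli (Set.Icc (-B) B) isCompact_Icc _ ?_ ?_
    · rintro _ x ⟨n, rfl⟩
      exact abs_le.1 (hB n x)
    · rw [Metric.uniformEquicontinuous_iff] at hw
      refine UniformEquicontinuous.equicontinuous (Metric.uniformEquicontinuous_iff.2 ?_)
      intro ε hε
      obtain ⟨δ, hδ, h⟩ := hw ε hε
      refine ⟨δ, hδ, fun x y hxy => ?_⟩
      rintro ⟨_, n, rfl⟩
      exact h x y hxy n
  obtain ⟨v, -, φ, hφ, hlim⟩ :=
    hcomp.tendsto_subseq fun n => subset_closure (Set.mem_range_self n)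
  exact ⟨φ, hφ, v, v.continuous,
    BoundedContinuousFunction.tendsto_iff_tendstoUniformly.1 hlim⟩

/-- Compact embedding `W^{1, L log L}(I) ↪ C(I)` on a bounded interval `I = (a,b)`, stated as
sequential compactness: a sequence of absolutely continuous functions `u_n` with derivatives
`g_n`, uniformly bounded in `L¹(I)` and with `‖g_n‖_{L log L(I)} ≤ C` (expressed via the
Luxemburg-norm defining inequality for every `λ > C`), has a subsequence converging uniformly
on `I` to a continuous function. -/
theorem compact_embedding_W1LlogL (a b : ℝ) (hab : a < b)
    (u g : ℕ → ℝ → ℝ) (C : ℝ) (hC : 0 ≤ C)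
    (hAC : ∀ n, ∀ s t : ℝ, a < s → s ≤ t → t < b →
      u n t - u n s = ∫ y in Set.Ioc s t, g n y)
    (hgint : ∀ n, IntegrableOn (g n) (Set.Ioo a b) volume)
    (huL1 : ∀ n, IntegrableOn (u n) (Set.Ioo a b) volume ∧
      ∫ x in Set.Ioo a b, |u n x| ≤ C)
    (hgLlogL : ∀ n, ∀ l : ℝ, C < l →
      ∫⁻ x in Set.Ioo a b,
        ENNReal.ofReal ((|g n x| / l) * Real.log (1 + |g n x| / l)) ≤ 1) :
    ∃ φ : ℕ → ℕ, StrictMono φ ∧ ∃ v : ℝ → ℝ,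
      ContinuousOn v (Set.Ioo a b) ∧
      TendstoUniformlyOn (fun n => u (φ n)) v Filter.atTop (Set.Ioo a b) := by
  set l := C + 1 with hl_def
  have hl : 0 < l := by linarith
  set c := (a + b) / 2 with hc_def
  have hac : a < c := by rw [hc_def]; linarith
  have hcb : c < b := by rw [hc_def]; linarith
  set G : ℕ → ℝ → ℝ := fun n => (Set.Ioo a b).indicator (g n) with hG
  have hGi : ∀ n, Integrable (G n) volume := fun n =>
    (hgint n).integrable_indicator measurableSet_Ioo
  have hmod : ∀ n s t, ∀ R : ℝ, 0 < R →
      |∫ y in s..t, G n y| ≤ l * (Real.exp R * |t - s| + 1 / R) := fun n s t R hR =>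
    abs_integral_indicator_le_of_LlogL hl hR (hgint n) (hgLlogL n l (by simp [hl_def])) s t
  have hle : ∀ n s t, a < s → s ≤ t → t < b → u n t - u n s = ∫ y in s..t, G n y := by
    intro n s t hs hst ht
    rw [hAC n s t hs hst ht, intervalIntegral.integral_of_le hst]
    refine setIntegral_congr_fun measurableSet_Ioc fun y hy => ?_
    have hy' : y ∈ Set.Ioo a b := ⟨hs.trans hy.1, hy.2.trans_lt ht⟩
    exact (Set.indicator_of_mem hy' (g n)).symm
  have hrep : ∀ n, ∀ x ∈ Set.Ioo a b, u n x = u n c + ∫ y in c..x, G n y := by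
    intro n x hx
    rcases le_total c x with h | h
    · linarith [hle n c x hac h hx.2]
    · rw [intervalIntegral.integral_symm]
      linarith [hle n x c hx.1 h hcb]
  set D := l * (Real.exp 1 * (b - a) + 1 / 1) with hD
  have hDb : ∀ n, ∀ x ∈ Set.Icc a b, |∫ y in c..x, G n y| ≤ D := by
    intro n x hx
    refine (hmod n c x 1 one_pos).trans ?_
    have : |x - c| ≤ b - a := abs_le.2 ⟨by linarith [hx.1], by linarith [hx.2]⟩
    rw [hD]
    gcongr
  have huc : ∀ n, |u n c| ≤ C / (b - a) + D := by
    intro n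
    have hpt : ∀ x ∈ Set.Ioo a b, |u n c| - D ≤ |u n x| := fun x hx => by
      have h1 := hDb n x (Set.Ioo_subset_Icc_self hx)
      have h2 := abs_sub (u n x) (∫ y in c..x, G n y)
      have h3 : u n x - ∫ y in c..x, G n y = u n c := by rw [hrep n x hx]; ring
      rw [h3] at h2
      linarith
    have hint : ∫ _ in Set.Ioo a b, (|u n c| - D) ≤ ∫ x in Set.Ioo a b, |u n x| :=
      setIntegral_mono_on (integrableOn_const (by simp)) (huL1 n).1.abs measurableSet_Ioo hpt
    rw [setIntegral_const, Real.volume_real_Ioo_of_le hab.le, smul_eq_mul] at hint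
    have : |u n c| - D ≤ C / (b - a) := by
      rw [le_div_iff₀ (sub_pos.2 hab)]
      linarith [(huL1 n).2]
    linarith
  let w : ℕ → Set.Icc a b → ℝ := fun n x => u n c + ∫ y in c..(x : ℝ), G n y
  have hwB : ∀ n x, |w n x| ≤ C / (b - a) + D + D := fun n x =>
    (abs_add_le _ _).trans (add_le_add (huc n) (hDb n x x.2))
  have hwE : UniformEquicontinuous w := by
    rw [Metric.uniformEquicontinuous_iff]
    intro ε hε
    set R := 2 * l / ε with hR_def
    have hR : 0 < R := by positivity
    have hlR : l * (1 / R) = ε / 2 := by rw [hR_def]; field_simp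
    refine ⟨ε / 2 / (l * Real.exp R), by positivity, fun x y hxy n => ?_⟩
    rw [lt_div_iff₀ (by positivity), Subtype.dist_eq, Real.dist_eq] at hxy
    have hsub : w n x - w n y = ∫ z in (y : ℝ)..x, G n z := by
      simp only [w, add_sub_add_left_eq_sub]
      exact intervalIntegral.integral_interval_sub_left (hGi n).intervalIntegrable
        (hGi n).intervalIntegrable
    rw [Real.dist_eq, hsub]
    linarith [hmod n y x R hR]
  obtain ⟨φ, hφ, v, hv, hlim⟩ := exists_subseq_tendstoUniformly hwB hwE
  refine ⟨φ, hφ, Set.IccExtend hab.le v, (hv.Icc_extend').continuousOn, ?_⟩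
  rw [Metric.tendstoUniformlyOn_iff]
  rw [Metric.tendstoUniformly_iff] at hlim
  intro ε hε
  filter_upwards [hlim ε hε] with n hn x hx
  have hx' := Set.Ioo_subset_Icc_self hx
  rw [Set.IccExtend_of_mem hab.le v hx', hrep (φ n) x hx]
  exact hn ⟨x, hx'⟩
end
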